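/- (Gustafson's C_n summation formula.) Let n ≥ 1 and let a_1, …, a_{2n+2} be nonzero generic parameters (the sums converge absolutely, a_1⋯a_{2n+2} ≠ 1, and Θ_G(x) ≠ 0). Then for every x = (x_1,…,x_n) ∈ (ℂ*)^n, ⟨⟨1, x⟩⟩_G = (1−q)^n (q)_∞^n ∏_{1 ≤ i < j ≤ 2n+2} (q a_i^{−1} a_j^{−1})_∞ / (q a_1^{−1} a_2^{−1} ⋯ a_{2n+2}^{−1})_∞; in particular ⟨⟨1,x⟩⟩_G does not depend on x. -/

import Mathlib

open Complex Finset

noncomputable section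

/-- The `q`-shifted factorial `(x;q)_∞ = ∏_{i≥0} (1 - q^i x)`. -/
def qp (q : ℝ) (x : ℂ) : ℂ := ∏' i : ℕ, (1 - (q : ℂ) ^ i * x)

/-- The theta function `θ(x) = (x;q)_∞ (q/x;q)_∞`. -/
def th (q : ℝ) (x : ℂ) : ℂ := qp q x * qp q ((q : ℂ) / x)

/-- `e(x;y) = x + x⁻¹ - (y + y⁻¹)`. -/
def efn (x y : ℂ) : ℂ := x + x⁻¹ - (y + y⁻¹)

/-- The value `Φ(q^ν ξ)` of the `BC₁` weight along the `q`-lattice through `ξ`,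
where the power `(q^ν ξ)^(1/2 - α m)` is interpreted as
`q^(ν/2) * (a m)^(-ν) * ξ^(1/2 - α m)` for the fixed (principal) branch of
`ξ^(1/2 - α m)`. -/
def PhiLat (q : ℝ) (s : ℕ) (a α : Fin (2 * s + 2) → ℂ) (ξ : ℂ) (ν : ℤ) : ℂ :=
  ∏ m, ((q : ℂ) ^ ((ν : ℂ) / 2) * a m ^ (-ν) * ξ ^ ((1 : ℂ) / 2 - α m) *
    (qp q ((q : ℂ) * ((q : ℂ) ^ ν * ξ) / a m) / qp q ((q : ℂ) ^ ν * ξ * a m)))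

/-- The `ν`-th summand `φ(q^ν ξ) Φ(q^ν ξ) Δ(q^ν ξ)` of the `BC₁`-type Jackson
integral `⟨φ,ξ⟩`. -/
def jSummand (q : ℝ) (s : ℕ) (a α : Fin (2 * s + 2) → ℂ) (φ : ℂ → ℂ) (ξ : ℂ) (ν : ℤ) : ℂ :=
  φ ((q : ℂ) ^ ν * ξ) * PhiLat q s a α ξ ν * (((q : ℂ) ^ ν * ξ)⁻¹ - (q : ℂ) ^ ν * ξ)

/-- The `BC₁`-type Jackson integral `⟨φ,ξ⟩ = (1-q) ∑_{ν∈ℤ} φ(q^ν ξ) Φ(q^ν ξ) Δ(q^ν ξ)`. -/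
def jInt (q : ℝ) (s : ℕ) (a α : Fin (2 * s + 2) → ℂ) (φ : ℂ → ℂ) (ξ : ℂ) : ℂ :=
  (1 - (q : ℂ)) * ∑' ν : ℤ, jSummand q s a α φ ξ ν

/-- `Θ(z) = z^(s - α₁ - ⋯ - α_{2s+2}) θ(z²) / ∏_m θ(a_m z)`. -/
def ThetaBC (q : ℝ) (s : ℕ) (a α : Fin (2 * s + 2) → ℂ) (z : ℂ) : ℂ :=
  z ^ ((s : ℂ) - ∑ m, α m) * th q (z ^ 2) / ∏ m, th q (a m * z)

/-- The `C_n` Weyl denominator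
`Δ_{C_n}(z) = ∏_i (1-z_i²)/z_i ∏_{j<k} (1-z_j/z_k)(1-z_j z_k)/z_j`. -/
def DeltaC (n : ℕ) (z : Fin n → ℂ) : ℂ :=
  (∏ i, (1 - z i ^ 2) / z i) *
    ∏ j, ∏ k ∈ Ioi j, ((1 - z j / z k) * (1 - z j * z k) / z j)

/-- The value `Φ_G(q^ν x)` of Gustafson's weight along the `q`-lattice through `x`,
with `(q^(ν i) x_i)^(1/2 - α m)` interpreted as
`q^(ν i/2) * (a m)^(-ν i) * (x i)^(1/2 - α m)` for the fixed (principal) branch. -/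
def PhiGLat (q : ℝ) (n : ℕ) (a α : Fin (2 * n + 2) → ℂ) (x : Fin n → ℂ)
    (ν : Fin n → ℤ) : ℂ :=
  ∏ i, ∏ m, ((q : ℂ) ^ ((ν i : ℂ) / 2) * a m ^ (-ν i) * x i ^ ((1 : ℂ) / 2 - α m) *
    (qp q ((q : ℂ) * (a m)⁻¹ * ((q : ℂ) ^ ν i * x i)) /
      qp q (a m * ((q : ℂ) ^ ν i * x i))))

/-- The `ν`-th summand `Φ_G(q^ν x) Δ_{C_n}(q^ν x)` of Gustafson's sum `⟨1,x⟩_G`. -/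
def gSummand (q : ℝ) (n : ℕ) (a α : Fin (2 * n + 2) → ℂ) (x : Fin n → ℂ)
    (ν : Fin n → ℤ) : ℂ :=
  PhiGLat q n a α x ν * DeltaC n fun i => (q : ℂ) ^ ν i * x i

/-- Gustafson's `C_n`-type Jackson integral
`⟨1,x⟩_G = (1-q)^n ∑_{ν ∈ ℤⁿ} Φ_G(q^ν x) Δ_{C_n}(q^ν x)`. -/
def gInt (q : ℝ) (n : ℕ) (a α : Fin (2 * n + 2) → ℂ) (x : Fin n → ℂ) : ℂ :=
  (1 - (q : ℂ)) ^ n * ∑' ν : Fin n → ℤ, gSummand q n a α x ν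

/-- `Θ_G(x) = ∏_i x_i^(i-α₁-⋯-α_{2n+2}) θ(x_i²)/∏_m θ(a_m x_i)
⋅ ∏_{j<k} θ(x_j/x_k) θ(x_j x_k)`. -/
def ThetaG (q : ℝ) (n : ℕ) (a α : Fin (2 * n + 2) → ℂ) (x : Fin n → ℂ) : ℂ :=
  (∏ i, (x i ^ (((i : ℕ) + 1 : ℂ) - ∑ m, α m) * th q (x i ^ 2) /
      ∏ m, th q (a m * x i))) *
    ∏ j, ∏ k ∈ Ioi j, (th q (x j / x k) * th q (x j * x k))

/-- Passing from a sequence of vectors to its consecutive differences, in the presence of a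
linear relation, multiplies the determinant by a quotient of sums of coefficients. -/
theorem det_sub_succ_of_relation {n : ℕ} (y : ℕ → Fin n → ℂ) (c : Fin (n + 1) → ℂ)
    (hc : ∀ j, ∑ k, c k * y k j = 0) :
    c (Fin.last n) * (Matrix.of fun i j : Fin n => y i j - y (i + 1) j).det =
      (∑ k, c k) * (Matrix.of fun i j : Fin n => y i j).det := by
  let Z : Matrix (Fin (n + 1)) (Fin (n + 1)) ℂ :=
    Matrix.of fun i => Fin.snoc (α := fun _ => ℂ) (y i) 1
  let Z' : Matrix (Fin (n + 1)) (Fin (n + 1)) ℂ :=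
    Matrix.of fun i => Fin.cases (Z 0) (fun k j => Z k.succ j - Z k.castSucc j) i
  have h1 : Z.det = Z'.det :=
    Matrix.det_eq_of_forall_row_eq_smul_add_pred (fun _ => 1) (fun j => rfl)
      (fun i j => by simp [Z'])
  have h2 : Z'.det = (Matrix.of fun i j : Fin n => y i j - y (i + 1) j).det := by
    rw [Matrix.det_succ_column Z' (Fin.last n), Fin.sum_univ_succ]
    have hz : ∀ i : Fin n, Z' i.succ (Fin.last n) = 0 := fun i => by simp [Z', Z]
    have hz0 : Z' 0 (Fin.last n) = 1 := by simp [Z', Z]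
    simp only [hz, hz0, mul_zero, zero_mul, Finset.sum_const_zero, add_zero, mul_one]
    have : Z'.submatrix (Fin.succAbove 0) (Fin.last n).succAbove =
        -(Matrix.of fun i j : Fin n => y i j - y (i + 1) j) := by
      ext i j
      simp [Z', Z]
    rw [this, Matrix.det_neg, ← mul_assoc]
    simp [← mul_pow]
  have h3 := Matrix.det_updateRow_sum Z (Fin.last n) c
  rw [smul_eq_mul, h1, h2] at h3
  rw [← h3, Matrix.det_succ_row _ (Fin.last n), Fin.sum_univ_castSucc]
  have hs : ∀ j : Fin n, (∑ k, c k • Z k) j.castSucc = 0 := fun j => by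
    simpa [Z, Finset.sum_apply] using hc j
  have hl : (∑ k, c k • Z k) (Fin.last n) = ∑ k, c k := by
    simp [Z, Finset.sum_apply]
  simp only [Matrix.updateRow_self, hs, hl, mul_zero, zero_mul, Finset.sum_const_zero, zero_add]
  rw [← two_mul, pow_mul]
  simp only [even_two, Even.neg_pow, one_pow, one_mul]
  congr 2
  ext i j
  simp [Z]

/-- `v` is a combination of `y 0, …, y n` with coefficient sum `s` and last coefficient `t`. -/
def IsComb {n : ℕ} (y : ℕ → Fin n → ℂ) (v : Fin n → ℂ) (s t : ℂ) : Prop :=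
  ∃ c : Fin (n + 1) → ℂ, (∀ j, ∑ k, c k * y k j = v j) ∧ ∑ k, c k = s ∧ c (Fin.last n) = t

theorem IsComb.zero {n : ℕ} (y : ℕ → Fin n → ℂ) : IsComb y (fun _ => 0) 0 0 :=
  ⟨fun _ => 0, by simp, by simp, rfl⟩

theorem IsComb.smul_add {n : ℕ} {y : ℕ → Fin n → ℂ} {v w : Fin n → ℂ} {s t s' t' : ℂ}
    (hv : IsComb y v s t) (hw : IsComb y w s' t') (r r' : ℂ) :
    IsComb y (fun j => r * v j + r' * w j) (r * s + r' * s') (r * t + r' * t') := by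
  obtain ⟨c, h1, h2, h3⟩ := hv
  obtain ⟨c', h1', h2', h3'⟩ := hw
  refine ⟨fun k => r * c k + r' * c' k, fun j => ?_, ?_, by simp [h3, h3']⟩
  · beta_reduce
    rw [← h1, ← h1', Finset.mul_sum, Finset.mul_sum, ← Finset.sum_add_distrib]
    exact Finset.sum_congr rfl fun k _ => by ring
  · rw [← h2, ← h2', Finset.mul_sum, Finset.mul_sum, ← Finset.sum_add_distrib]

theorem IsComb.sum {n : ℕ} {y : ℕ → Fin n → ℂ} {ι : Type*} (u : Finset ι) (r : ι → ℂ)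
    (v : ι → Fin n → ℂ) (s t : ι → ℂ) (h : ∀ i ∈ u, IsComb y (v i) (s i) (t i)) :
    IsComb y (fun j => ∑ i ∈ u, r i * v i j) (∑ i ∈ u, r i * s i) (∑ i ∈ u, r i * t i) := by
  classical
  induction u using Finset.induction_on with
  | empty => simpa using IsComb.zero y
  | insert i u hi ih =>
    simp only [Finset.sum_insert hi]
    simpa using (h i (Finset.mem_insert_self i u)).smul_add
      (ih fun k hk => h k (Finset.mem_insert_of_mem hk)) (r i) 1

theorem IsComb.self {n : ℕ} (y : ℕ → Fin n → ℂ) {k : ℕ} (hk : k ≤ n) :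
    IsComb y (y k) 1 (if k = n then 1 else 0) := by
  refine ⟨Pi.single (⟨k, by omega⟩ : Fin (n + 1)) 1, fun j => ?_, by simp, ?_⟩
  · rw [Finset.sum_eq_single (⟨k, by omega⟩ : Fin (n + 1))]
    · simp
    · intro b _ hb
      simp [hb]
    · simp
  · by_cases h : k = n
    · subst h
      simp [Fin.last]
    · rw [if_neg h, Pi.single_eq_of_ne]
      intro h'
      exact h (by simpa using (congrArg Fin.val h').symm)

section Shift

variable {n : ℕ} (S : Fin n → ℤ → ℂ) (b : ℂ)

/-- The rescaled first differences of an odd family of sequences. -/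
def scaledDiff (k : ℕ) (j : Fin n) : ℂ := b ^ k * (S j (k + 1) - b * S j k)

variable {S b}

theorem isComb_diff_pos (hb : b ≠ 0) {k : ℕ} (hk : k ≤ n) :
    IsComb (scaledDiff S b) (fun j => S j (k + 1) - b * S j k) (b ^ (-(k : ℤ)))
      (if k = n then b ^ (-(n : ℤ)) else 0) := by
  have h := (IsComb.self (scaledDiff S b) hk).smul_add (IsComb.zero _) (b ^ (-(k : ℤ))) 0
  convert! h using 1
  · ext j
    simp [scaledDiff, hb]
  · simp
  · by_cases h : k = n <;> simp [h]

theorem isComb_pair (hb : b ≠ 0) (h0 : ∀ j, S j 0 = 0) {k : ℕ} (hk : k ≤ n) :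
    ∃ s s' : ℂ, IsComb (scaledDiff S b) (fun j => S j k) s 0 ∧
      IsComb (scaledDiff S b) (fun j => S j (k + 1)) s' (if k = n then b ^ (-(n : ℤ)) else 0) ∧
      s' = b ^ (-(k : ℤ)) + b * s ∧ b * s' - s = b ^ (k + 1) := by
  induction k with
  | zero =>
    refine ⟨0, 1, by simpa [h0] using IsComb.zero (scaledDiff S b), ?_, by simp, by simp⟩
    simpa [h0] using isComb_diff_pos (S := S) hb hk
  | succ k ih =>
    obtain ⟨s, s', -, h2, h3, h4⟩ := ih (by omega)
    rw [if_neg (by omega)] at h2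
    refine ⟨s', b ^ (-((k + 1 : ℕ) : ℤ)) + b * s', by simpa using h2, ?_, rfl, ?_⟩
    · have := (isComb_diff_pos (S := S) hb hk).smul_add h2 1 b
      convert! this using 1
      · ext j
        push_cast
        ring
      · ring
      · ring
    · have e : b * b ^ (-((k + 1 : ℕ) : ℤ)) = b ^ (-(k : ℤ)) := by
        rw [← zpow_one_add₀ hb]
        congr 1
        push_cast
        ring
      linear_combination e + b * h4 - h3

theorem isComb_diff_neg (hb : b ≠ 0) (hodd : ∀ j k, S j (-k) = -S j k) {k : ℕ} (hk : k ≤ n) :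
    IsComb (scaledDiff S b) (fun j => S j (-(k : ℤ)) - b * S j (-(k : ℤ) - 1)) (b ^ (k + 1))
      (if k = n then b * b ^ (-(n : ℤ)) else 0) := by
  have h0 : ∀ j, S j 0 = 0 := fun j => by
    have := hodd j 0
    rw [neg_zero] at this
    linear_combination this / 2
  obtain ⟨s, s', h1, h2, -, h4⟩ := isComb_pair (S := S) hb h0 hk
  have := h2.smul_add h1 b (-1)
  convert! this using 1
  · ext j
    rw [show -(k : ℤ) - 1 = -(k + 1) by ring, hodd, hodd]
    ring
  · rw [← h4]
    ring
  · by_cases h : k = n <;> simp [h]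

/-- The determinant of an odd family subject to a linear relation of length `2n + 2`, after
multiplication by `1 + b² - b (T + T⁻¹)` with `T` the shift. -/
theorem det_shift_of_relation (hb : b ≠ 0) (hodd : ∀ j k, S j (-k) = -S j k) (d : ℕ → ℂ)
    (hrel : ∀ j, ∑ k ∈ range (2 * n + 2),
      d k * (S j ((n : ℤ) + 1 - k) - b * S j ((n : ℤ) - k)) = 0) :
    (d 0 + b * d (2 * n + 1)) *
        (Matrix.of fun i j : Fin n => (1 + b ^ 2) * S j ((i : ℕ) + 1 : ℤ) -
          b * (S j ((i : ℕ) + 1 + 1 : ℤ) + S j ((i : ℕ) : ℤ))).det =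
      (∑ k ∈ range (2 * n + 2), d k * b ^ k) *
        (Matrix.of fun i j : Fin n => S j ((i : ℕ) + 1 : ℤ)).det := by
  have h0 : ∀ j, S j 0 = 0 := fun j => by
    have := hodd j 0
    rw [neg_zero] at this
    linear_combination this / 2
  have key : ∀ k ∈ range (2 * n + 2), IsComb (scaledDiff S b)
      (fun j => S j ((n : ℤ) + 1 - k) - b * S j ((n : ℤ) - k)) (b ^ (-(n : ℤ)) * b ^ k)
      (if k = 0 then b ^ (-(n : ℤ)) else if k = 2 * n + 1 then b * b ^ (-(n : ℤ)) else 0) := by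
    intro k hk
    rw [mem_range] at hk
    by_cases hkn : k ≤ n
    · have := isComb_diff_pos (S := S) hb (Nat.sub_le n k)
      convert! this using 1
      · ext j
        rw [Nat.cast_sub hkn]
        congr 2; ring_nf
      · rw [Nat.cast_sub hkn, ← zpow_natCast b k, ← zpow_add₀ hb]
        congr 1
        ring
      · by_cases hk0 : k = 0
        · simp [hk0]
        · rw [if_neg hk0, if_neg (by omega), if_neg (by omega)]
    · have := isComb_diff_neg (S := S) hb hodd (k := k - (n + 1)) (by omega)
      have hc : ((k - (n + 1) : ℕ) : ℤ) = k - (n + 1) := by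
        rw [Nat.cast_sub (by omega)]
        push_cast
        ring
      convert! this using 1
      · ext j
        rw [hc]
        congr 2 <;> ring_nf
      · rw [← zpow_natCast b k, ← zpow_add₀ hb, ← zpow_natCast b]
        congr 1
        push_cast
        rw [hc]
        ring
      · by_cases hk0 : k = 2 * n + 1
        · rw [if_neg (by omega), if_pos hk0, if_pos (by omega)]
        · rw [if_neg (by omega), if_neg hk0, if_neg (by omega)]
  obtain ⟨c, hc, hsum, hlast⟩ := IsComb.sum _ d _ _ _ key
  have hdet := det_sub_succ_of_relation (scaledDiff S b) c (fun j => (hc j).trans (hrel j))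
  have hl : c (Fin.last n) = b ^ (-(n : ℤ)) * (d 0 + b * d (2 * n + 1)) := by
    rw [hlast, Finset.sum_range_succ, Finset.sum_range_succ']
    rw [Finset.sum_eq_zero]
    · simp
      ring
    · intro k hk
      rw [mem_range] at hk
      rw [if_neg (by omega), if_neg (by omega), mul_zero]
  have hs : ∑ k, c k = b ^ (-(n : ℤ)) * ∑ k ∈ range (2 * n + 2), d k * b ^ k := by
    rw [hsum, Finset.mul_sum]
    exact Finset.sum_congr rfl fun k _ => by ring
  have e1 : (Matrix.of fun i j : Fin n => scaledDiff S b i j - scaledDiff S b (i + 1) j).det =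
      (∏ i : Fin n, b ^ (i : ℕ)) *
        (Matrix.of fun i j : Fin n => (1 + b ^ 2) * S j ((i : ℕ) + 1 : ℤ) -
          b * (S j ((i : ℕ) + 1 + 1 : ℤ) + S j ((i : ℕ) : ℤ))).det := by
    rw [← Matrix.det_mul_column]
    congr 1
    ext i j
    simp only [scaledDiff, Matrix.of_apply]
    push_cast
    ring
  have e2 : (Matrix.of fun i j : Fin n => scaledDiff S b i j).det =
      (∏ i : Fin n, b ^ (i : ℕ)) * (Matrix.of fun i j : Fin n => S j ((i : ℕ) + 1 : ℤ)).det := by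
    have : (Matrix.of fun i j : Fin n => S j ((i : ℕ) + 1 : ℤ)).det =
        (Matrix.of fun i j : Fin n => S j ((i : ℕ) + 1 : ℤ) - b * S j ((i : ℕ) : ℤ)).det := by
      cases n with
      | zero => simp
      | succ p =>
        refine Matrix.det_eq_of_forall_row_eq_smul_add_pred (fun _ => b) (fun j => ?_)
          (fun i j => ?_)
        · simp [h0]
        · simp
    rw [this, ← Matrix.det_mul_column]
    rfl
  rw [e1, e2, hl, hs] at hdet
  have hne : b ^ (-(n : ℤ)) * ∏ i : Fin n, b ^ (i : ℕ) ≠ 0 :=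
    mul_ne_zero (zpow_ne_zero _ hb) (Finset.prod_ne_zero_iff.mpr fun i _ => pow_ne_zero _ hb)
  refine mul_left_cancel₀ hne ?_
  linear_combination hdet

end Shift

open Filter Topology

section QPochhammer

variable {q : ℝ}

theorem norm_ofReal_lt_one (hq0 : 0 < q) (hq1 : q < 1) : ‖(q : ℂ)‖ < 1 := by
  rwa [Complex.norm_real, Real.norm_of_nonneg hq0.le]

theorem summable_norm_geometric_mul (hq0 : 0 < q) (hq1 : q < 1) (x : ℂ) :
    Summable fun i : ℕ => ‖-((q : ℂ) ^ i * x)‖ := by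
  simp only [norm_neg, norm_mul, norm_pow]
  exact (summable_geometric_of_lt_one (norm_nonneg _) (norm_ofReal_lt_one hq0 hq1)).mul_right _

theorem multipliable_qp (hq0 : 0 < q) (hq1 : q < 1) (x : ℂ) :
    Multipliable fun i : ℕ => 1 - (q : ℂ) ^ i * x := by
  simpa [sub_eq_add_neg] using
    multipliable_one_add_of_summable (summable_norm_geometric_mul hq0 hq1 x)

theorem qp_eq_mul (hq0 : 0 < q) (hq1 : q < 1) (x : ℂ) :
    qp q x = (1 - x) * qp q ((q : ℂ) * x) := by
  have h : ∀ i : ℕ, (q : ℂ) ^ (i + 1) * x = (q : ℂ) ^ i * ((q : ℂ) * x) := fun i => by ring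
  unfold qp
  rw [tprod_eq_zero_mul' (by simpa only [h] using multipliable_qp hq0 hq1 ((q : ℂ) * x))]
  simp only [h, pow_zero, one_mul]

@[simp]
theorem qp_zero : qp q 0 = 1 := by simp [qp]

theorem qp_inv_pow (hq0 : 0 < q) (k : ℕ) : qp q (((q : ℂ) ^ k)⁻¹) = 0 := by
  refine tprod_of_exists_eq_zero ⟨k, ?_⟩
  rw [mul_inv_cancel₀ (pow_ne_zero _ (by exact_mod_cast hq0.ne')), sub_self]

theorem tendsto_qp (hq0 : 0 < q) (hq1 : q < 1) {ι : Type*} {l : Filter ι} {u : ι → ℂ} {c : ℂ}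
    (hu : Tendsto u l (𝓝 c)) : Tendsto (fun i => qp q (u i)) l (𝓝 (qp q c)) := by
  simp only [qp, sub_eq_add_neg]
  refine tendsto_tprod_one_add_of_dominated_convergence
    (bound := fun i : ℕ => ‖(q : ℂ)‖ ^ i * (‖c‖ + 1))
    ((summable_geometric_of_lt_one (norm_nonneg _) (norm_ofReal_lt_one hq0 hq1)).mul_right _)
    (fun k => (hu.const_mul _).neg) ?_
  have : ∀ᶠ i in l, ‖u i‖ < ‖c‖ + 1 := hu.norm.eventually_lt_const (by linarith)
  filter_upwards [this] with i hi k
  rw [norm_neg, norm_mul, norm_pow]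
  gcongr

/-- Finite products converge to the infinite one. -/
theorem tendsto_prod_qp (hq0 : 0 < q) (hq1 : q < 1) (x : ℂ) :
    Tendsto (fun N => ∏ i ∈ range N, (1 - (q : ℂ) ^ i * x)) atTop (𝓝 (qp q x)) :=
  (multipliable_qp hq0 hq1 x).hasProd.tendsto_prod_nat

/-- A majorant of `qp`, monotone in the modulus of the argument. -/
theorem norm_qp_le (hq0 : 0 < q) (hq1 : q < 1) {x : ℂ} {r : ℝ} (hr : ‖x‖ ≤ r) :
    ‖qp q x‖ ≤ ‖qp q (-(r : ℂ))‖ := by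
  refine le_of_tendsto_of_tendsto' (tendsto_prod_qp hq0 hq1 x).norm
    (tendsto_prod_qp hq0 hq1 (-(r : ℂ))).norm fun N => ?_
  rw [norm_prod, norm_prod]
  refine Finset.prod_le_prod (fun _ _ => norm_nonneg _) fun i _ => ?_
  have hr0 : 0 ≤ r := (norm_nonneg x).trans hr
  have : ‖1 - (q : ℂ) ^ i * -(r : ℂ)‖ = 1 + q ^ i * r := by
    rw [show 1 - (q : ℂ) ^ i * -(r : ℂ) = ((1 + q ^ i * r : ℝ) : ℂ) by push_cast; ring,
      Complex.norm_real, Real.norm_of_nonneg (by positivity)]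
  rw [this]
  calc ‖1 - (q : ℂ) ^ i * x‖ ≤ ‖(1 : ℂ)‖ + ‖(q : ℂ) ^ i * x‖ := norm_sub_le _ _
    _ = 1 + q ^ i * ‖x‖ := by
      rw [norm_one, norm_mul, norm_pow, Complex.norm_real, Real.norm_of_nonneg hq0.le]
    _ ≤ _ := by gcongr

theorem tendsto_zpow_mul_zero (hq0 : 0 < q) (hq1 : q < 1) (x : ℂ) :
    Tendsto (fun t : ℕ => (q : ℂ) ^ (t : ℤ) * x) atTop (𝓝 0) := by
  simpa using (tendsto_pow_atTop_nhds_zero_of_norm_lt_one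
    (norm_ofReal_lt_one hq0 hq1)).mul_const x

end QPochhammer

section Weight

/-- Gustafson's one-variable weight at `q^ν x`, in terms of the reciprocal parameters `b`, and
multiplied by the theta factors of its denominator. -/
def wt (q : ℝ) (n : ℕ) (b : ℕ → ℂ) (x : ℂ) (ν : ℤ) : ℂ :=
  x ^ ((2 * n + 2) * ν : ℤ) * (q : ℂ) ^ ((n + 1) * ν ^ 2 : ℤ) *
    ∏ m ∈ range (2 * n + 2),
      (qp q (q * b m * ((q : ℂ) ^ ν * x)) * qp q (q * b m / ((q : ℂ) ^ ν * x)))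

variable {q : ℝ} {n : ℕ} {b : ℕ → ℂ} {x : ℂ}

theorem zpow_mul_ne_zero (hq0 : 0 < q) (hx : x ≠ 0) (ν : ℤ) : (q : ℂ) ^ ν * x ≠ 0 :=
  mul_ne_zero (zpow_ne_zero _ (by exact_mod_cast hq0.ne')) hx

theorem wt_neg (q : ℝ) (n : ℕ) (b : ℕ → ℂ) (x : ℂ) (ν : ℤ) : wt q n b x (-ν) = wt q n b x⁻¹ ν := by
  have e : (q : ℂ) ^ (-ν) * x = ((q : ℂ) ^ ν * x⁻¹)⁻¹ := by
    rw [mul_inv, inv_inv, zpow_neg]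
  unfold wt
  rw [e, mul_neg, zpow_neg, inv_zpow, neg_sq]
  congr 1
  refine Finset.prod_congr rfl fun m _ => ?_
  rw [div_inv_eq_mul, ← div_eq_mul_inv, mul_comm]

theorem wt_succ (hq0 : 0 < q) (hq1 : q < 1) (hx : x ≠ 0) (ν : ℤ) :
    wt q n b x (ν + 1) * ∏ m ∈ range (2 * n + 2), (1 - q * b m * ((q : ℂ) ^ ν * x)) =
      wt q n b x ν * (q : ℂ) ^ (n + 1) *
        ∏ m ∈ range (2 * n + 2), ((q : ℂ) ^ ν * x - b m) := by
  have hQ : (q : ℂ) ≠ 0 := by exact_mod_cast hq0.ne'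
  set z := (q : ℂ) ^ ν * x with hz
  have hz0 : z ≠ 0 := zpow_mul_ne_zero hq0 hx ν
  have e : (q : ℂ) ^ (ν + 1) * x = q * z := by rw [hz, zpow_add_one₀ hQ]; ring
  have e2 : x ^ ((2 * n + 2) * (ν + 1) : ℤ) * (q : ℂ) ^ ((n + 1) * (ν + 1) ^ 2 : ℤ) =
      x ^ ((2 * n + 2) * ν : ℤ) * (q : ℂ) ^ ((n + 1) * ν ^ 2 : ℤ) * (q : ℂ) ^ (n + 1) *
        z ^ (2 * n + 2) := by
    have h1 : z ^ (2 * n + 2) = (q : ℂ) ^ ((2 * n + 2) * ν : ℤ) * x ^ (2 * n + 2 : ℤ) := by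
      rw [hz, mul_pow, ← zpow_natCast, ← zpow_natCast, ← zpow_mul]
      push_cast
      rw [mul_comm ν]
    rw [h1, ← zpow_natCast (q : ℂ) (n + 1),
      show ((n + 1) * (ν + 1) ^ 2 : ℤ) = (n + 1) * ν ^ 2 + ((n + 1 : ℕ) : ℤ) + (2 * n + 2) * ν by
        push_cast; ring,
      show ((2 * n + 2) * (ν + 1) : ℤ) = (2 * n + 2) * ν + (2 * n + 2) by ring,
      zpow_add₀ hQ, zpow_add₀ hQ, zpow_add₀ hx]
    ring
  unfold wt
  rw [e, e2, ← hz]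
  have e3 : ∏ m ∈ range (2 * n + 2), (qp q (q * b m * (q * z)) * qp q (q * b m / (q * z))) *
        (1 - q * b m * z) * z =
      ∏ m ∈ range (2 * n + 2), (qp q (q * b m * z) * qp q (q * b m / z)) * (z - b m) := by
    refine Finset.prod_congr rfl fun m _ => ?_
    rw [mul_div_mul_left _ _ hQ, qp_eq_mul hq0 hq1 (q * b m * z), qp_eq_mul hq0 hq1 (b m / z),
      show (q : ℂ) * (q * b m * z) = q * b m * (q * z) by ring, ← mul_div_assoc]
    field_simp
  simp only [Finset.prod_mul_distrib, Finset.prod_const, card_range] at e3 ⊢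
  clear_value z
  linear_combination x ^ ((2 * n + 2) * ν : ℤ) * (q : ℂ) ^ ((n + 1) * ν ^ 2 : ℤ) *
    (q : ℂ) ^ (n + 1) * e3

theorem summable_nat_wt_mul_zpow (hq0 : 0 < q) (hq1 : q < 1) (hx : x ≠ 0) (k : ℤ)
    (hB : q ^ (n + 1 + k : ℤ) * ‖∏ m ∈ range (2 * n + 2), b m‖ < 1) :
    Summable fun t : ℕ => wt q n b x t * ((q : ℂ) ^ (t : ℤ) * x) ^ k := by
  have hQ : (q : ℂ) ≠ 0 := by exact_mod_cast hq0.ne'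
  have hz := tendsto_zpow_mul_zero hq0 hq1 x
  have h1 : Tendsto (fun t : ℕ => ‖∏ m ∈ range (2 * n + 2),
      (1 - q * b m * ((q : ℂ) ^ (t : ℤ) * x))‖) atTop (𝓝 1) := by
    have : Tendsto (fun t : ℕ => ∏ m ∈ range (2 * n + 2),
        (1 - q * b m * ((q : ℂ) ^ (t : ℤ) * x))) atTop
        (𝓝 (∏ m ∈ range (2 * n + 2), (1 - q * b m * 0))) :=
      tendsto_finsetProd _ fun m _ => (hz.const_mul _).const_sub _
    simpa using this.norm
  have h2 : Tendsto (fun t : ℕ => ‖∏ m ∈ range (2 * n + 2),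
      ((q : ℂ) ^ (t : ℤ) * x - b m)‖) atTop (𝓝 ‖∏ m ∈ range (2 * n + 2), b m‖) := by
    have : Tendsto (fun t : ℕ => ∏ m ∈ range (2 * n + 2),
        ((q : ℂ) ^ (t : ℤ) * x - b m)) atTop
        (𝓝 (∏ m ∈ range (2 * n + 2), (0 - b m))) :=
      tendsto_finsetProd _ fun m _ => hz.sub_const _
    simpa [Finset.prod_neg] using this.norm
  have h3 : Tendsto (fun t : ℕ => q ^ (n + 1 + k : ℤ) *
      (‖∏ m ∈ range (2 * n + 2), ((q : ℂ) ^ (t : ℤ) * x - b m)‖ /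
        ‖∏ m ∈ range (2 * n + 2), (1 - q * b m * ((q : ℂ) ^ (t : ℤ) * x))‖)) atTop
      (𝓝 (q ^ (n + 1 + k : ℤ) * ‖∏ m ∈ range (2 * n + 2), b m‖)) := by
    simpa using (h2.div h1 one_ne_zero).const_mul (q ^ (n + 1 + k : ℤ))
  obtain ⟨r, hr, hr1⟩ := exists_between hB
  refine summable_of_ratio_norm_eventually_le hr1 ?_
  filter_upwards [h3.eventually_lt_const hr, h1.eventually_const_lt one_half_lt_one] with t ht ht'
  have hpos : 0 < ‖∏ m ∈ range (2 * n + 2), (1 - q * b m * ((q : ℂ) ^ (t : ℤ) * x))‖ := by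
    linarith
  have hw := congrArg norm (wt_succ (n := n) (b := b) hq0 hq1 hx t)
  have e : (q : ℂ) ^ ((t + 1 : ℕ) : ℤ) * x = q * ((q : ℂ) ^ (t : ℤ) * x) := by
    push_cast
    rw [zpow_add_one₀ hQ]
    ring
  have hqk : ‖(q : ℂ) ^ k‖ = q ^ k := by
    rw [norm_zpow, Complex.norm_real, Real.norm_of_nonneg hq0.le]
  rw [e, mul_zpow, norm_mul, norm_mul, norm_mul, hqk]
  simp only [norm_mul (wt _ _ _ _ _ * _), norm_mul (wt _ _ _ _ _), norm_pow, Complex.norm_real,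
    Real.norm_of_nonneg hq0.le] at hw
  push_cast
  rw [← eq_div_iff hpos.ne'] at hw
  rw [hw]
  rw [zpow_add₀ hq0.ne', show (n + 1 : ℤ) = ((n + 1 : ℕ) : ℤ) by push_cast; rfl, zpow_natCast] at ht
  calc _ = q ^ (n + 1) * q ^ k * (‖∏ m ∈ range (2 * n + 2), ((q : ℂ) ^ (t : ℤ) * x - b m)‖ /
        ‖∏ m ∈ range (2 * n + 2), (1 - q * b m * ((q : ℂ) ^ (t : ℤ) * x))‖) *
        (‖wt q n b x t‖ * ‖((q : ℂ) ^ (t : ℤ) * x) ^ k‖) := by ring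
    _ ≤ _ := by gcongr

theorem summable_wt_mul_zpow (hq0 : 0 < q) (hq1 : q < 1) (hx : x ≠ 0) (k : ℤ)
    (hB : q ^ (n + 1 + k : ℤ) * ‖∏ m ∈ range (2 * n + 2), b m‖ < 1)
    (hB' : q ^ (n + 1 - k : ℤ) * ‖∏ m ∈ range (2 * n + 2), b m‖ < 1) :
    Summable fun ν : ℤ => wt q n b x ν * ((q : ℂ) ^ ν * x) ^ k := by
  refine Summable.of_nat_of_neg (summable_nat_wt_mul_zpow hq0 hq1 hx k hB) ?_
  convert! summable_nat_wt_mul_zpow hq0 hq1 (inv_ne_zero hx) (-k) hB' using 2 with t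
  rw [wt_neg, zpow_neg _ k, ← inv_zpow, mul_inv, inv_inv, zpow_neg]

end Weight

section Moments

/-- The bilateral moments of `wt`. -/
def wtMoment (q : ℝ) (n : ℕ) (b : ℕ → ℂ) (x : ℂ) (k : ℤ) : ℂ :=
  ∑' ν : ℤ, wt q n b x ν * ((q : ℂ) ^ ν * x) ^ k

/-- The determinant of the odd moments `∑ wt(z) (z^(-k) - z^k)`, `1 ≤ k ≤ n`. -/
def momentDet (q : ℝ) (n : ℕ) (b : ℕ → ℂ) (x : Fin n → ℂ) : ℂ :=
  (Matrix.of fun i j : Fin n =>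
    wtMoment q n b (x j) (-((i : ℕ) + 1 : ℤ)) - wtMoment q n b (x j) ((i : ℕ) + 1 : ℤ)).det

variable {q : ℝ} {n : ℕ} {b : ℕ → ℂ} {x : ℂ}

theorem wt_congr {b' : ℕ → ℂ} (h : ∀ m < 2 * n + 2, b m = b' m) (ν : ℤ) :
    wt q n b x ν = wt q n b' x ν := by
  unfold wt
  congr 1
  exact Finset.prod_congr rfl fun m hm => by rw [h m (mem_range.mp hm)]

theorem momentDet_congr {b' : ℕ → ℂ} (h : ∀ m < 2 * n + 2, b m = b' m) (x : Fin n → ℂ) :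
    momentDet q n b x = momentDet q n b' x := by
  simp only [momentDet, wtMoment, wt_congr h]

theorem summable_wt_of_abs (hq0 : 0 < q) (hq1 : q < 1) (hx : x ≠ 0) (k : ℤ)
    (hB : q ^ (n + 1 - |k| : ℤ) * ‖∏ m ∈ range (2 * n + 2), b m‖ < 1) :
    Summable fun ν : ℤ => wt q n b x ν * ((q : ℂ) ^ ν * x) ^ k := by
  have hmono : ∀ i j : ℤ, i ≤ j → q ^ j ≤ q ^ i := fun i j h =>
    zpow_le_zpow_right_of_le_one₀ hq0 hq1.le h
  refine summable_wt_mul_zpow hq0 hq1 hx k (lt_of_le_of_lt ?_ hB) (lt_of_le_of_lt ?_ hB)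
  · gcongr 1
    exact hmono _ _ (by linarith [neg_abs_le k])
  · gcongr 1
    exact hmono _ _ (by linarith [le_abs_self k])

theorem summable_wt_of_abs_le (hq0 : 0 < q) (hq1 : q < 1) (hx : x ≠ 0) {k : ℤ} (hk : |k| ≤ n)
    (hB : q * ‖∏ m ∈ range (2 * n + 2), b m‖ < 1) :
    Summable fun ν : ℤ => wt q n b x ν * ((q : ℂ) ^ ν * x) ^ k := by
  refine summable_wt_of_abs hq0 hq1 hx k (lt_of_le_of_lt ?_ hB)
  gcongr 1
  simpa using zpow_le_zpow_right_of_le_one₀ hq0 hq1.le (show (1 : ℤ) ≤ n + 1 - |k| by linarith)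

theorem summable_wt_of_abs_le_succ (hq0 : 0 < q) (hq1 : q < 1) (hx : x ≠ 0) {k : ℤ}
    (hk : |k| ≤ n + 1) (hB : ‖∏ m ∈ range (2 * n + 2), b m‖ < 1) :
    Summable fun ν : ℤ => wt q n b x ν * ((q : ℂ) ^ ν * x) ^ k := by
  refine summable_wt_of_abs hq0 hq1 hx k (lt_of_le_of_lt ?_ hB)
  have := zpow_le_zpow_right_of_le_one₀ hq0 hq1.le (show (0 : ℤ) ≤ n + 1 - |k| by linarith)
  rw [zpow_zero] at this
  exact mul_le_of_le_one_left (norm_nonneg _) this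

theorem wt_eq_wt_update (hq0 : 0 < q) (hq1 : q < 1) {m : ℕ} (hm : m < 2 * n + 2) (ν : ℤ) :
    wt q n b x ν = wt q n (Function.update b m (q * b m)) x ν *
      ((1 - q * b m * ((q : ℂ) ^ ν * x)) * (1 - q * b m / ((q : ℂ) ^ ν * x))) := by
  have hm' := mem_range.mpr hm
  unfold wt
  rw [← Finset.mul_prod_erase _ _ hm', ← Finset.mul_prod_erase _ _ hm',
    qp_eq_mul hq0 hq1 (q * b m * _), qp_eq_mul hq0 hq1 (q * b m / _), Function.update_self]
  have : ∏ i ∈ (range (2 * n + 2)).erase m,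
      (qp q (q * Function.update b m (q * b m) i * ((q : ℂ) ^ ν * x)) *
        qp q (q * Function.update b m (q * b m) i / ((q : ℂ) ^ ν * x))) =
      ∏ i ∈ (range (2 * n + 2)).erase m,
        (qp q (q * b i * ((q : ℂ) ^ ν * x)) * qp q (q * b i / ((q : ℂ) ^ ν * x))) :=
    Finset.prod_congr rfl fun i hi => by
      rw [Function.update_of_ne (Finset.ne_of_mem_erase hi)]
  rw [this, ← mul_assoc (q : ℂ) (q * b m), ← mul_div_assoc (q : ℂ) (q * b m)]
  ring

theorem prod_update_range {m M : ℕ} (hm : m < M) (b : ℕ → ℂ) (c : ℂ) :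
    ∏ i ∈ range M, Function.update b m c i = c * ∏ i ∈ (range M).erase m, b i := by
  rw [Finset.prod_update_of_mem (mem_range.mpr hm), Finset.erase_eq]

theorem wtMoment_eq_update (hq0 : 0 < q) (hq1 : q < 1) (hx : x ≠ 0) {m : ℕ} (hm : m < 2 * n + 2)
    (hB : q * ‖∏ m ∈ range (2 * n + 2), b m‖ < 1) {k : ℤ} (hk : |k| ≤ n) :
    wtMoment q n b x k = (1 + (q * b m) ^ 2) * wtMoment q n (Function.update b m (q * b m)) x k -
      q * b m * (wtMoment q n (Function.update b m (q * b m)) x (k + 1) +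
        wtMoment q n (Function.update b m (q * b m)) x (k - 1)) := by
  have hB' : ‖∏ i ∈ range (2 * n + 2), Function.update b m (q * b m) i‖ < 1 := by
    rwa [prod_update_range hm, mul_assoc, Finset.mul_prod_erase _ _ (mem_range.mpr hm), norm_mul,
      Complex.norm_real, Real.norm_of_nonneg hq0.le]
  have hs : ∀ {i : ℤ}, |i| ≤ n + 1 → Summable _ := fun {i} hi =>
    summable_wt_of_abs_le_succ hq0 hq1 hx hi hB'
  rw [abs_le] at hk
  have h0 := hs (i := k) (abs_le.mpr ⟨by linarith, by linarith⟩)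
  have h1 := hs (i := k + 1) (abs_le.mpr ⟨by linarith, by linarith⟩)
  have h2 := hs (i := k - 1) (abs_le.mpr ⟨by linarith, by linarith⟩)
  unfold wtMoment
  rw [← Summable.tsum_add h1 h2, ← tsum_mul_left, ← tsum_mul_left,
    ← Summable.tsum_sub (h0.mul_left _) ((h1.add h2).mul_left _)]
  refine tsum_congr fun ν => ?_
  have hz := zpow_mul_ne_zero hq0 hx ν
  rw [wt_eq_wt_update hq0 hq1 hm, zpow_add_one₀ hz, zpow_sub_one₀ hz]
  generalize (q : ℂ) ^ ν * x = z at hz ⊢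
  field_simp
  ring

/-- The linear relation among the moments coming from a total difference. -/
theorem wtMoment_relation (hq0 : 0 < q) (hq1 : q < 1) (hx : x ≠ 0)
    (hB : ‖∏ m ∈ range (2 * n + 2), b m‖ < 1) (c : ℂ) (p : Polynomial ℂ)
    (hp : p.natDegree < 2 * n + 2)
    (hcp : ∀ z, ∏ m ∈ range (2 * n + 2), (1 - b m * z) = (1 - c * z) * p.eval z) :
    ∑ k ∈ range (2 * n + 2), p.coeff k *
        (wtMoment q n b x (k - n - 1) - c * wtMoment q n b x (k - n)) =
      ∑ k ∈ range (2 * n + 2), p.coeff k *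
        (wtMoment q n b x (n + 1 - k) - c * wtMoment q n b x (n - k)) := by
  have hQ : (q : ℂ) ≠ 0 := by exact_mod_cast hq0.ne'
  have hs : ∀ {i : ℤ}, |i| ≤ n + 1 → Summable _ := fun {i} hi =>
    summable_wt_of_abs_le_succ hq0 hq1 hx hi hB
  have tsum_comb : ∀ u v : ℕ → ℤ, (∀ k < 2 * n + 2, |u k| ≤ n + 1) →
      (∀ k < 2 * n + 2, |v k| ≤ n + 1) →
      ∑ k ∈ range (2 * n + 2), p.coeff k *
        (wtMoment q n b x (u k) - c * wtMoment q n b x (v k)) =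
      ∑' ν : ℤ, ∑ k ∈ range (2 * n + 2), p.coeff k *
        (wt q n b x ν * ((q : ℂ) ^ ν * x) ^ u k -
          c * (wt q n b x ν * ((q : ℂ) ^ ν * x) ^ v k)) := by
    intro u v hu hv
    rw [Summable.tsum_finsetSum]
    · refine Finset.sum_congr rfl fun k hk => ?_
      rw [mem_range] at hk
      rw [tsum_mul_left, Summable.tsum_sub (hs (hu k hk)) ((hs (hv k hk)).mul_left _),
        tsum_mul_left]
      rfl
    · intro k hk
      rw [mem_range] at hk
      exact ((hs (hu k hk)).sub ((hs (hv k hk)).mul_left _)).mul_left _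
  rw [tsum_comb, tsum_comb, ← (Equiv.addRight (1 : ℤ)).tsum_eq]
  · refine tsum_congr fun ν => ?_
    set z := (q : ℂ) ^ ν * x with hzdef
    have hz : z ≠ 0 := zpow_mul_ne_zero hq0 hx ν
    have e : (q : ℂ) ^ (ν + 1) * x = q * z := by rw [hzdef, zpow_add_one₀ hQ]; ring
    simp only [Equiv.coe_addRight]
    rw [e]
    have hqz : (q : ℂ) * z ≠ 0 := mul_ne_zero hQ hz
    have L : ∀ w y : ℂ, y ≠ 0 → ∑ k ∈ range (2 * n + 2), p.coeff k *
        (w * y ^ ((k : ℤ) - n - 1) - c * (w * y ^ ((k : ℤ) - n))) =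
        w * (y ^ (n + 1))⁻¹ * ((1 - c * y) * p.eval y) := by
      intro w y hy
      rw [Polynomial.eval_eq_sum_range' hp, Finset.mul_sum, Finset.mul_sum]
      refine Finset.sum_congr rfl fun k _ => ?_
      rw [zpow_sub_one₀ hy, zpow_sub₀ hy, zpow_natCast, zpow_natCast, pow_succ]
      field_simp
    have R : ∀ w y : ℂ, y ≠ 0 → ∑ k ∈ range (2 * n + 2), p.coeff k *
        (w * y ^ ((n : ℤ) + 1 - k) - c * (w * y ^ ((n : ℤ) - k))) =
        w * y ^ (n + 1) * ((1 - c * y⁻¹) * p.eval y⁻¹) := by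
      intro w y hy
      rw [← inv_inv (y ^ (n + 1)), ← inv_pow, ← L w y⁻¹ (inv_ne_zero hy)]
      refine Finset.sum_congr rfl fun k _ => ?_
      rw [inv_zpow', inv_zpow']
      congr 4 <;> ring_nf
    rw [L _ _ hqz, R _ _ hz, ← hcp, ← hcp]
    have hw := wt_succ (n := n) (b := b) hq0 hq1 hx ν
    rw [← hzdef] at hw
    have e1 : ∏ m ∈ range (2 * n + 2), (1 - b m * (q * z)) =
        ∏ m ∈ range (2 * n + 2), (1 - q * b m * z) :=
      Finset.prod_congr rfl fun m _ => by ring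
    have e2 : ∏ m ∈ range (2 * n + 2), (z - b m) =
        z ^ (n + 1) * z ^ (n + 1) * ∏ m ∈ range (2 * n + 2), (1 - b m * z⁻¹) := by
      rw [← pow_add, show n + 1 + (n + 1) = 2 * n + 2 by ring,
        show z ^ (2 * n + 2) = ∏ _m ∈ range (2 * n + 2), z by simp, ← Finset.prod_mul_distrib]
      refine Finset.prod_congr rfl fun m _ => ?_
      field_simp
    rw [e1, mul_right_comm, hw, e2, mul_pow (q : ℂ) z]
    clear_value z
    generalize ∏ m ∈ range (2 * n + 2), (1 - b m * z⁻¹) = P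
    field_simp
  · intro k hk
    rw [abs_le]
    constructor <;> omega
  · intro k hk
    rw [abs_le]
    constructor <;> omega
  · intro k hk
    rw [abs_le]
    constructor <;> omega
  · intro k hk
    rw [abs_le]
    constructor <;> omega

theorem momentDet_update (hq0 : 0 < q) (hq1 : q < 1) {x : Fin n → ℂ} (hx : ∀ i, x i ≠ 0) {m : ℕ}
    (hm : m < 2 * n + 2) (hB : q * ‖∏ m ∈ range (2 * n + 2), b m‖ < 1) :
    (1 - q * ∏ i ∈ range (2 * n + 2), b i) * momentDet q n b x =
      (∏ i ∈ (range (2 * n + 2)).erase m, (1 - q * b m * b i)) *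
        momentDet q n (Function.update b m (q * b m)) x := by
  have hmr := mem_range.mpr hm
  by_cases hbm : b m = 0
  · rw [hbm, mul_zero, ← hbm, Function.update_eq_self, Finset.prod_eq_zero hmr hbm, hbm]
    simp
  have hQ : (q : ℂ) ≠ 0 := by exact_mod_cast hq0.ne'
  have hc : q * b m ≠ 0 := mul_ne_zero hQ hbm
  set b' := Function.update b m (q * b m) with hb'
  have hB' : ‖∏ i ∈ range (2 * n + 2), b' i‖ < 1 := by
    rwa [prod_update_range hm, mul_assoc, Finset.mul_prod_erase _ _ hmr, norm_mul,
      Complex.norm_real, Real.norm_of_nonneg hq0.le]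
  let p : Polynomial ℂ := ∏ i ∈ (range (2 * n + 2)).erase m,
    (1 - Polynomial.C (b i) * Polynomial.X)
  have hcard : ((range (2 * n + 2)).erase m).card = 2 * n + 1 := by
    rw [Finset.card_erase_of_mem hmr, card_range]
    rfl
  have hdeg1 : ∀ i ∈ (range (2 * n + 2)).erase m,
      (1 - Polynomial.C (b i) * Polynomial.X : Polynomial ℂ).natDegree ≤ 1 := fun i _ => by
    compute_degree
  have hdeg : p.natDegree < 2 * n + 2 := by
    refine Nat.lt_succ_of_le ((Polynomial.natDegree_prod_le _ _).trans ?_)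
    refine (Finset.sum_le_card_nsmul _ _ 1 hdeg1).trans ?_
    simp [hcard]
  have heval : ∀ z, p.eval z = ∏ i ∈ (range (2 * n + 2)).erase m, (1 - b i * z) := fun z => by
    simp [p, Polynomial.eval_prod]
  have hcoeff0 : p.coeff 0 = 1 := by
    rw [Polynomial.coeff_zero_eq_eval_zero, heval]
    simp
  have hcoeff : p.coeff (2 * n + 1) = -∏ i ∈ (range (2 * n + 2)).erase m, b i := by
    have := Polynomial.coeff_prod_of_natDegree_le _ _ 1 hdeg1
    rw [hcard, mul_one] at this
    have h1 : ∀ i, (1 - Polynomial.C (b i) * Polynomial.X : Polynomial ℂ).coeff 1 = -b i :=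
      fun i => by simp [Polynomial.coeff_one]
    simp only [h1] at this
    rw [this, Finset.prod_neg, hcard]
    simp [pow_succ, pow_mul]
  have hcp : ∀ z, ∏ i ∈ range (2 * n + 2), (1 - b' i * z) = (1 - q * b m * z) * p.eval z := by
    intro z
    rw [heval, ← Finset.mul_prod_erase _ _ hmr, hb', Function.update_self]
    congr 1
    exact Finset.prod_congr rfl fun i hi => by
      rw [Function.update_of_ne (Finset.ne_of_mem_erase hi)]
  let S : Fin n → ℤ → ℂ := fun j k => wtMoment q n b' (x j) (-k) - wtMoment q n b' (x j) k
  have key := det_shift_of_relation (S := S) hc (fun j k => by simp [S]) p.coeff (fun j => by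
    have h := wtMoment_relation hq0 hq1 (hx j) hB' (q * b m) p hdeg hcp
    rw [← sub_eq_zero, ← Finset.sum_sub_distrib] at h
    rw [← h]
    refine Finset.sum_congr rfl fun k _ => ?_
    simp only [S]
    rw [show -((n : ℤ) + 1 - k) = k - n - 1 by ring, show -((n : ℤ) - k) = k - n by ring]
    ring)
  have hprod : q * ∏ i ∈ range (2 * n + 2), b i =
      q * b m * ∏ i ∈ (range (2 * n + 2)).erase m, b i := by
    rw [mul_assoc, Finset.mul_prod_erase _ _ hmr]
  have hL : momentDet q n b x = (Matrix.of fun i j : Fin n =>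
      (1 + (q * b m) ^ 2) * S j ((i : ℕ) + 1 : ℤ) -
        q * b m * (S j ((i : ℕ) + 1 + 1 : ℤ) + S j ((i : ℕ) : ℤ))).det := by
    unfold momentDet
    congr 1
    ext i j
    have hi : ((i : ℕ) : ℤ) + 1 ≤ n := by exact_mod_cast i.2
    have hi' : |((i : ℕ) : ℤ) + 1| ≤ n := by rwa [abs_of_nonneg (by positivity)]
    simp only [Matrix.of_apply, S]
    rw [wtMoment_eq_update hq0 hq1 (hx j) hm hB hi',
      wtMoment_eq_update hq0 hq1 (hx j) hm hB (k := -(((i : ℕ) : ℤ) + 1)) (by rwa [abs_neg])]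
    rw [show -(((i : ℕ) : ℤ) + 1) + 1 = -((i : ℕ) : ℤ) by ring,
      show -(((i : ℕ) : ℤ) + 1) - 1 = -(((i : ℕ) : ℤ) + 1 + 1) by ring,
      show ((i : ℕ) : ℤ) + 1 - 1 = ((i : ℕ) : ℤ) by ring]
    ring
  rw [hL, hprod]
  rw [hcoeff0, hcoeff, ← Polynomial.eval_eq_sum_range' hdeg, heval] at key
  have hpr : ∏ i ∈ (range (2 * n + 2)).erase m, (1 - q * b m * b i) =
      ∏ i ∈ (range (2 * n + 2)).erase m, (1 - b i * (q * b m)) :=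
    Finset.prod_congr rfl fun i _ => by ring
  rw [hpr]
  unfold momentDet
  linear_combination key

end Moments

section Limit

variable {q : ℝ} {n : ℕ} {b : ℕ → ℂ}

theorem norm_wt_le (hq0 : 0 < q) (hq1 : q < 1) {b' : ℕ → ℂ} (h : ∀ m, ‖b' m‖ ≤ ‖b m‖) (x : ℂ)
    (ν : ℤ) : ‖wt q n b' x ν‖ ≤ ‖wt q n (fun m => (‖b m‖ : ℂ)) (-(‖x‖ : ℂ)) ν‖ := by
  unfold wt
  simp only [norm_mul, norm_zpow, norm_prod, norm_neg, Complex.norm_real, norm_norm]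
  gcongr with m _
  · have e : (q : ℂ) * ‖b m‖ * ((q : ℂ) ^ ν * -(‖x‖ : ℂ)) =
        -((q * ‖b m‖ * (q ^ ν * ‖x‖) : ℝ) : ℂ) := by push_cast; ring
    rw [e]
    refine norm_qp_le hq0 hq1 ?_
    simp only [norm_mul, norm_zpow, Complex.norm_real, Real.norm_of_nonneg hq0.le]
    gcongr
    exact h m
  · have e : (q : ℂ) * ‖b m‖ / ((q : ℂ) ^ ν * -(‖x‖ : ℂ)) =
        -((q * ‖b m‖ / (q ^ ν * ‖x‖) : ℝ) : ℂ) := by push_cast; rw [mul_neg, div_neg]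
    rw [e]
    refine norm_qp_le hq0 hq1 ?_
    simp only [norm_mul, norm_div, norm_zpow, Complex.norm_real, Real.norm_of_nonneg hq0.le]
    gcongr
    exact h m

theorem tendsto_wtMoment (hq0 : 0 < q) (hq1 : q < 1) {x : ℂ} (hx : x ≠ 0)
    (hB : q * ‖∏ m ∈ range (2 * n + 2), b m‖ < 1) {u : ℕ → ℕ → ℂ} {c : ℕ → ℂ}
    (hu : ∀ N m, ‖u N m‖ ≤ ‖b m‖) (hc : ∀ m, Tendsto (fun N => u N m) atTop (𝓝 (c m)))
    {k : ℤ} (hk : |k| ≤ n) :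
    Tendsto (fun N => wtMoment q n (u N) x k) atTop (𝓝 (wtMoment q n c x k)) := by
  have hx' : -(‖x‖ : ℂ) ≠ 0 := by simpa using hx
  have hB' : q * ‖∏ m ∈ range (2 * n + 2), (‖b m‖ : ℂ)‖ < 1 := by
    simpa [norm_prod] using hB
  refine tendsto_tsum_of_dominated_convergence
    (summable_wt_of_abs_le hq0 hq1 hx' hk hB').norm (fun ν => ?_) (Eventually.of_forall ?_)
  · refine Tendsto.mul_const _ (Tendsto.const_mul _ (tendsto_finsetProd _ fun m _ => ?_))
    exact (tendsto_qp hq0 hq1 (((hc m).const_mul _).mul_const _)).mul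
      (tendsto_qp hq0 hq1 (((hc m).const_mul _).div_const _))
  · intro N ν
    rw [norm_mul, norm_mul]
    refine mul_le_mul (norm_wt_le hq0 hq1 (hu N) x ν) (le_of_eq ?_) (norm_nonneg _) (norm_nonneg _)
    simp

theorem tendsto_momentDet (hq0 : 0 < q) (hq1 : q < 1) {x : Fin n → ℂ} (hx : ∀ i, x i ≠ 0)
    (hB : q * ‖∏ m ∈ range (2 * n + 2), b m‖ < 1) {u : ℕ → ℕ → ℂ} {c : ℕ → ℂ}
    (hu : ∀ N m, ‖u N m‖ ≤ ‖b m‖) (hc : ∀ m, Tendsto (fun N => u N m) atTop (𝓝 (c m))) :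
    Tendsto (fun N => momentDet q n (u N) x) atTop (𝓝 (momentDet q n c x)) := by
  refine ((Continuous.matrix_det continuous_id).tendsto _).comp ?_
  refine tendsto_pi_nhds.mpr fun i => tendsto_pi_nhds.mpr fun j => ?_
  have hi : |((i : ℕ) : ℤ) + 1| ≤ n := by
    rw [abs_of_nonneg (by positivity)]
    exact_mod_cast i.2
  exact (tendsto_wtMoment hq0 hq1 (hx j) hB hu hc (by rwa [abs_neg])).sub
    (tendsto_wtMoment hq0 hq1 (hx j) hB hu hc hi)

theorem momentDet_update_pow (hq0 : 0 < q) (hq1 : q < 1) {x : Fin n → ℂ} (hx : ∀ i, x i ≠ 0)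
    {m : ℕ} (hm : m < 2 * n + 2) (hB : q * ‖∏ m ∈ range (2 * n + 2), b m‖ < 1) (N : ℕ) :
    (∏ j ∈ range N, (1 - (q : ℂ) ^ j * (q * ∏ i ∈ range (2 * n + 2), b i))) * momentDet q n b x =
      (∏ i ∈ (range (2 * n + 2)).erase m, ∏ j ∈ range N, (1 - (q : ℂ) ^ j * (q * b m * b i))) *
        momentDet q n (Function.update b m ((q : ℂ) ^ N * b m)) x := by
  have hmr := mem_range.mpr hm
  induction N with
  | zero => simp
  | succ N ih =>
    set b' := Function.update b m ((q : ℂ) ^ N * b m) with hb'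
    have hB' : ∏ i ∈ range (2 * n + 2), b' i = (q : ℂ) ^ N * ∏ i ∈ range (2 * n + 2), b i := by
      rw [hb', prod_update_range hm, mul_assoc, Finset.mul_prod_erase _ _ hmr]
    have hlt : q * ‖∏ i ∈ range (2 * n + 2), b' i‖ < 1 := by
      refine lt_of_le_of_lt ?_ hB
      rw [hB', norm_mul, norm_pow]
      gcongr
      exact mul_le_of_le_one_left (norm_nonneg _)
        (pow_le_one₀ (norm_nonneg _) (norm_ofReal_lt_one hq0 hq1).le)
    have step := momentDet_update hq0 hq1 hx hm hlt
    rw [hB'] at step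
    have hupd : Function.update b' m (q * b' m) =
        Function.update b m ((q : ℂ) ^ (N + 1) * b m) := by
      rw [hb', Function.update_idem, Function.update_self]
      congr 1
      ring
    rw [hupd] at step
    have hpr : ∏ i ∈ (range (2 * n + 2)).erase m, (1 - q * b' m * b' i) =
        ∏ i ∈ (range (2 * n + 2)).erase m, (1 - (q : ℂ) ^ N * (q * b m * b i)) :=
      Finset.prod_congr rfl fun i hi => by
        rw [hb', Function.update_self, Function.update_of_ne (Finset.ne_of_mem_erase hi)]
        ring
    rw [hpr] at step
    simp only [fun f : ℕ → ℂ => Finset.prod_range_succ f N, Finset.prod_mul_distrib]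
    linear_combination (1 - (q : ℂ) ^ N * (q * ∏ i ∈ range (2 * n + 2), b i)) * ih +
      (∏ i ∈ (range (2 * n + 2)).erase m, ∏ j ∈ range N, (1 - (q : ℂ) ^ j * (q * b m * b i))) *
        step

theorem momentDet_update_zero (hq0 : 0 < q) (hq1 : q < 1) {x : Fin n → ℂ} (hx : ∀ i, x i ≠ 0)
    {m : ℕ} (hm : m < 2 * n + 2) (hB : q * ‖∏ m ∈ range (2 * n + 2), b m‖ < 1) :
    qp q (q * ∏ i ∈ range (2 * n + 2), b i) * momentDet q n b x =
      (∏ i ∈ (range (2 * n + 2)).erase m, qp q (q * b m * b i)) *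
        momentDet q n (Function.update b m 0) x := by
  refine tendsto_nhds_unique ((tendsto_prod_qp hq0 hq1 _).mul_const _) ?_
  simp only [momentDet_update_pow hq0 hq1 hx hm hB]
  refine (tendsto_finsetProd _ fun i _ => tendsto_prod_qp hq0 hq1 _).mul
    (tendsto_momentDet hq0 hq1 hx hB (fun N i => ?_) fun i => ?_)
  · rcases eq_or_ne i m with rfl | hi
    · rw [Function.update_self, norm_mul, norm_pow]
      exact mul_le_of_le_one_left (norm_nonneg _)
        (pow_le_one₀ (norm_nonneg _) (norm_ofReal_lt_one hq0 hq1).le)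
    · rw [Function.update_of_ne hi]
  · rcases eq_or_ne i m with rfl | hi
    · simp only [Function.update_self]
      simpa using (tendsto_pow_atTop_nhds_zero_of_norm_lt_one
        (norm_ofReal_lt_one hq0 hq1)).mul_const (b i)
    · simp only [Function.update_of_ne hi]
      exact tendsto_const_nhds

theorem momentDet_of_eq_zero (hq0 : 0 < q) (hq1 : q < 1) {x : Fin n → ℂ} (hx : ∀ i, x i ≠ 0)
    {t : ℕ} (ht : t ≤ 2 * n + 2) (hB : q * ‖∏ m ∈ range (2 * n + 2), b m‖ < 1)
    (hb : ∀ m < 2 * n + 2, t ≤ m → b m = 0) :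
    qp q (q * ∏ i ∈ range (2 * n + 2), b i) * momentDet q n b x =
      (∏ j ∈ range t, ∏ i ∈ range j, qp q (q * b j * b i)) * momentDet q n 0 x := by
  induction t generalizing b with
  | zero =>
    rw [Finset.prod_eq_zero (mem_range.mpr (Nat.succ_pos _)) (hb 0 (by omega) le_rfl), mul_zero,
      qp_zero, range_zero, Finset.prod_empty]
    congr 1
    exact momentDet_congr (fun m hm => hb m hm (Nat.zero_le m)) x
  | succ t ih =>
    have htr : t ∈ range (2 * n + 2) := mem_range.mpr ht
    have h0 : ∏ i ∈ range (2 * n + 2), Function.update b t 0 i = 0 := by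
      rw [prod_update_range ht, zero_mul]
    have hrec := ih (b := Function.update b t 0) (by omega) (by simp [h0]) fun m hm htm => by
      rcases eq_or_ne m t with rfl | hmt
      · exact Function.update_self ..
      · rw [Function.update_of_ne hmt]
        exact hb m hm (by omega)
    rw [h0, mul_zero, qp_zero, one_mul] at hrec
    rw [momentDet_update_zero hq0 hq1 hx ht hB, hrec, Finset.prod_range_succ, ← mul_assoc,
      mul_comm (∏ i ∈ _, _)]
    congr 2
    · refine Finset.prod_congr rfl fun j hj => Finset.prod_congr rfl fun i hi => ?_
      rw [mem_range] at hi hj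
      rw [Function.update_of_ne (by omega), Function.update_of_ne (by omega)]
    · refine (Finset.prod_subset (fun i hi => ?_) fun i hi hi' => ?_).symm
      · rw [mem_range] at hi
        exact mem_erase.mpr ⟨by omega, mem_range.mpr (by omega)⟩
      · rw [mem_erase, mem_range] at hi
        rw [mem_range] at hi'
        rw [hb i hi.2 (by omega), mul_zero, qp_zero]

/-- The moment determinant as an explicit product, up to its value at `b = 0`. -/
theorem qp_mul_momentDet (hq0 : 0 < q) (hq1 : q < 1) {x : Fin n → ℂ} (hx : ∀ i, x i ≠ 0)
    (hB : q * ‖∏ m ∈ range (2 * n + 2), b m‖ < 1) :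
    qp q (q * ∏ i ∈ range (2 * n + 2), b i) * momentDet q n b x =
      (∏ j ∈ range (2 * n + 2), ∏ i ∈ range j, qp q (q * b j * b i)) * momentDet q n 0 x :=
  momentDet_of_eq_zero hq0 hq1 hx le_rfl hB fun _ h h' => absurd h h'.not_gt

end Limit

section Denominator

theorem exists_monic_odd_quotient (k : ℕ) : ∃ p : Polynomial ℂ, p.Monic ∧ p.natDegree = k ∧
    ∀ z : ℂ, z ≠ 0 → (z⁻¹ - z) * p.eval (z + z⁻¹) = z ^ (-(k + 1 : ℤ)) - z ^ (k + 1 : ℤ) := by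
  induction k using Nat.twoStepInduction with
  | zero => exact ⟨1, Polynomial.monic_one, Polynomial.natDegree_one, fun z _ => by simp⟩
  | one =>
    refine ⟨Polynomial.X, Polynomial.monic_X, Polynomial.natDegree_X, fun z hz => ?_⟩
    rw [Polynomial.eval_X, zpow_neg]
    norm_num [zpow_two]
    field_simp
    ring
  | more k ih0 ih1 =>
    obtain ⟨p, hp, hpd, hpe⟩ := ih0
    obtain ⟨r, hr, hrd, hre⟩ := ih1
    have hd : (Polynomial.X * r).natDegree = k + 2 := by
      rw [Polynomial.natDegree_X_mul hr.ne_zero, hrd]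
    have hlt : p.natDegree < (Polynomial.X * r).natDegree := by omega
    refine ⟨Polynomial.X * r - p, (Polynomial.monic_X.mul hr).sub_of_left
      (Polynomial.degree_lt_degree hlt), ?_, fun z hz => ?_⟩
    · rw [Polynomial.natDegree_sub_eq_left_of_natDegree_lt hlt, hd]
    · have h0 := hpe z hz
      have h1 := hre z hz
      push_cast at h1 ⊢
      rw [Polynomial.eval_sub, Polynomial.eval_mul, Polynomial.eval_X, mul_sub, h0,
        mul_left_comm, h1]
      rw [show (k : ℤ) + 2 + 1 = k + 1 + 1 + 1 by ring]
      simp only [zpow_neg, zpow_add_one₀ hz, zpow_natCast]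
      field_simp
      ring

/-- The Weyl denominator as a determinant. -/
theorem DeltaC_eq_det {n : ℕ} {z : Fin n → ℂ} (hz : ∀ i, z i ≠ 0) :
    DeltaC n z = (∏ j : Fin n, ∏ _k ∈ Ioi j, (-1)) *
      (Matrix.of fun i j : Fin n =>
        z j ^ (-((i : ℕ) + 1 : ℤ)) - z j ^ ((i : ℕ) + 1 : ℤ)).det := by
  choose p hp hpd hpe using exists_monic_odd_quotient
  have h := Matrix.det_eval_matrixOfPolynomials_eq_det_vandermonde (fun j => z j + (z j)⁻¹)
    (fun i : Fin n => p i) (fun i => hpd i) fun i => hp i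
  rw [Matrix.det_vandermonde, ← Matrix.det_transpose] at h
  have h2 : (Matrix.of fun i j : Fin n =>
      z j ^ (-((i : ℕ) + 1 : ℤ)) - z j ^ ((i : ℕ) + 1 : ℤ)).det =
      (∏ j, ((z j)⁻¹ - z j)) * (Matrix.of fun i j : Fin n =>
        (p j).eval (z i + (z i)⁻¹)).transpose.det := by
    rw [← Matrix.det_mul_row]
    congr 1
    ext i j
    exact (hpe i (z j) (hz j)).symm
  rw [h2, ← h, mul_left_comm, ← Finset.prod_mul_distrib, DeltaC]
  congr 1
  · refine Finset.prod_congr rfl fun j _ => ?_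
    have := hz j
    field_simp
  · refine Finset.prod_congr rfl fun j _ => ?_
    rw [← Finset.prod_mul_distrib]
    refine Finset.prod_congr rfl fun k _ => ?_
    have := hz j
    have := hz k
    field_simp
    ring

theorem prod_prod_Ioi_neg_one_mul_self (n : ℕ) :
    (∏ j : Fin n, ∏ _k ∈ Ioi j, (-1 : ℂ)) * (∏ j : Fin n, ∏ _k ∈ Ioi j, (-1)) = 1 := by
  rw [← Finset.prod_mul_distrib]
  refine Finset.prod_eq_one fun j _ => ?_
  rw [← Finset.prod_mul_distrib]
  simp

end Denominator

section Products

theorem prod_range_two_mul (f : ℕ → ℂ) (n : ℕ) :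
    ∏ m ∈ range (2 * n), f m = ∏ i ∈ range n, (f (2 * i) * f (2 * i + 1)) := by
  induction n with
  | zero => simp
  | succ n ih => rw [mul_add, Finset.prod_range_succ, Finset.prod_range_succ, ih,
      Finset.prod_range_succ, mul_assoc]

theorem prod_range_prod_range (f : ℕ → ℕ → ℂ) (n : ℕ) :
    ∏ j ∈ range n, ∏ i ∈ range j, f i j = ∏ i : Fin n, ∏ j ∈ Ioi i, f i j := by
  have h : ∀ i : Fin n, ∏ j ∈ Ioi i, f i j = ∏ j : Fin n, if i < j then f i j else 1 := fun i => by
    rw [← Finset.prod_filter]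
    congr 1
    ext j
    simp
  simp only [h]
  rw [Finset.prod_comm, Finset.prod_range]
  refine Finset.prod_congr rfl fun j _ => ?_
  have h2 : ∏ i : Fin n, (if i < j then f i j else 1) =
      ∏ i : Fin n, (fun i : ℕ => if i < (j : ℕ) then f i j else 1) i := rfl
  rw [h2, ← Finset.prod_range fun i : ℕ => if i < (j : ℕ) then f i j else 1,
    ← Finset.prod_filter]
  congr 1
  ext i
  have := j.2
  simp
  omega

theorem prod_prod_of_symm {n : ℕ} (g : Fin n → Fin n → ℂ) (hg : ∀ i j, g i j = g j i) :
    ∏ j, ∏ i, g i j = (∏ j, g j j) * (∏ j, ∏ k ∈ Ioi j, g j k) ^ 2 := by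
  have h : (∏ j, ∏ k ∈ Ioi j, g j k) ^ 2 = ∏ i, ∏ j ∈ {i}ᶜ, g j i := by
    rw [← prod_prod_Ioi_mul_eq_prod_prod_off_diag, sq, ← Finset.prod_mul_distrib]
    simp only [← Finset.prod_mul_distrib]
    exact Finset.prod_congr rfl fun j _ => Finset.prod_congr rfl fun k _ => by rw [hg k j]
  rw [h, ← Finset.prod_mul_distrib]
  exact Finset.prod_congr rfl fun j _ => Fintype.prod_eq_mul_prod_compl j (fun i => g i j)

end Products

section Special

/-- The product `(quv)(qu/v)(qv/u)(q/uv)` of `q`-shifted factorials. -/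
def gq (q : ℝ) (u v : ℂ) : ℂ :=
  qp q (q * u * v) * qp q (q * u / v) * qp q (q * v / u) * qp q (q / (u * v))

/-- The parameters `X₀, X₀⁻¹, …, X_{n-1}, X_{n-1}⁻¹, 0, 0, …`. -/
def pairParams (n : ℕ) (X : ℕ → ℂ) (m : ℕ) : ℂ :=
  if m < 2 * n then if m % 2 = 0 then X (m / 2) else (X (m / 2))⁻¹ else 0

variable {q : ℝ} {n : ℕ} {X : ℕ → ℂ}

theorem gq_comm (u v : ℂ) : gq q u v = gq q v u := by
  unfold gq
  rw [mul_right_comm (q : ℂ) u v, mul_comm u v]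
  ring

theorem gq_self {u : ℂ} (hu : u ≠ 0) : gq q u u =
    qp q q ^ 2 * (qp q (q * u ^ 2) * qp q (q / u ^ 2)) := by
  unfold gq
  rw [mul_div_assoc, div_self hu, mul_one, mul_assoc (q : ℂ), ← sq]
  ring

theorem pairParams_even {i : ℕ} (hi : i < n) : pairParams n X (2 * i) = X i := by
  rw [pairParams, if_pos (by omega), if_pos (by omega), Nat.mul_div_cancel_left _ two_pos]

theorem pairParams_odd {i : ℕ} (hi : i < n) : pairParams n X (2 * i + 1) = (X i)⁻¹ := by
  rw [pairParams, if_pos (by omega), if_neg (by omega), show (2 * i + 1) / 2 = i by omega]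

theorem pairParams_of_le {m : ℕ} (hm : 2 * n ≤ m) : pairParams n X m = 0 := by
  rw [pairParams, if_neg (by omega)]

theorem wt_pairParams_zero (j : ℕ) :
    wt q n (pairParams n X) (X j) 0 = ∏ i ∈ range n, gq q (X i) (X j) := by
  unfold wt
  simp only [Finset.prod_range_succ _ (2 * n + 1), Finset.prod_range_succ _ (2 * n),
    pairParams_of_le le_rfl, pairParams_of_le (Nat.le_succ _), prod_range_two_mul]
  simp only [zpow_zero, one_mul, mul_zero, zero_mul, zero_div, qp_zero, mul_one, ne_eq,
    OfNat.ofNat_ne_zero, not_false_eq_true, zero_pow]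
  refine Finset.prod_congr rfl fun i hi => ?_
  rw [mem_range] at hi
  rw [pairParams_even hi, pairParams_odd hi, gq, ← div_eq_mul_inv, div_mul_eq_mul_div,
    div_div]
  ring

theorem wt_pairParams_of_ne_zero (hq0 : 0 < q) (hX : ∀ i, X i ≠ 0) {j : ℕ} (hj : j < n) {ν : ℤ}
    (hν : ν ≠ 0) : wt q n (pairParams n X) (X j) ν = 0 := by
  have hQ : (q : ℂ) ≠ 0 := by exact_mod_cast hq0.ne'
  have hXj := hX j
  unfold wt
  rcases hν.lt_or_gt with h | h
  · obtain ⟨k, rfl⟩ : ∃ k : ℕ, ν = -(k + 1 : ℤ) := ⟨(-ν - 1).toNat, by omega⟩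
    refine mul_eq_zero_of_right _ (Finset.prod_eq_zero (i := 2 * j + 1)
      (mem_range.mpr (by omega)) (mul_eq_zero_of_left ?_ _))
    rw [pairParams_odd hj, ← qp_inv_pow hq0 k]
    congr 1
    rw [zpow_neg, zpow_add_one₀ hQ, zpow_natCast]
    field_simp
  · obtain ⟨k, rfl⟩ : ∃ k : ℕ, ν = (k + 1 : ℤ) := ⟨(ν - 1).toNat, by omega⟩
    refine mul_eq_zero_of_right _ (Finset.prod_eq_zero (i := 2 * j)
      (mem_range.mpr (by omega)) (mul_eq_zero_of_right _ ?_))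
    rw [pairParams_even hj, ← qp_inv_pow hq0 k]
    congr 1
    rw [zpow_add_one₀ hQ, zpow_natCast]
    field_simp

theorem wtMoment_pairParams (hq0 : 0 < q) (hX : ∀ i, X i ≠ 0) {j : ℕ} (hj : j < n) (k : ℤ) :
    wtMoment q n (pairParams n X) (X j) k = (∏ i ∈ range n, gq q (X i) (X j)) * X j ^ k := by
  unfold wtMoment
  rw [tsum_eq_single 0 fun ν hν => by rw [wt_pairParams_of_ne_zero hq0 hX hj hν, zero_mul],
    wt_pairParams_zero, zpow_zero, one_mul]

theorem prod_prod_qp_pairParams (hX : ∀ i, X i ≠ 0) :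
    ∏ j ∈ range (2 * n + 2), ∏ i ∈ range j,
        qp q (q * pairParams n X j * pairParams n X i) =
      qp q q ^ n * ∏ j ∈ range n, ∏ i ∈ range j, gq q (X i) (X j) := by
  rw [Finset.prod_range_succ _ (2 * n + 1), Finset.prod_range_succ _ (2 * n),
    pairParams_of_le le_rfl, pairParams_of_le (Nat.le_succ _), prod_range_two_mul]
  simp only [mul_zero, zero_mul, qp_zero, Finset.prod_const_one, mul_one]
  rw [← card_range n, ← Finset.prod_const, card_range, ← Finset.prod_mul_distrib]
  refine Finset.prod_congr rfl fun j hj => ?_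
  rw [mem_range] at hj
  rw [Finset.prod_range_succ _ (2 * j), prod_range_two_mul, prod_range_two_mul,
    pairParams_even hj, pairParams_odd hj]
  rw [mul_right_comm (q : ℂ) (X j)⁻¹ (X j), mul_inv_cancel_right₀ (hX j)]
  rw [← mul_assoc, mul_comm _ (qp q q), ← Finset.prod_mul_distrib]
  congr 1
  refine Finset.prod_congr rfl fun i hi => ?_
  rw [mem_range] at hi
  rw [pairParams_even (hi.trans hj), pairParams_odd (hi.trans hj), gq]
  have h1 : (q : ℂ) * X j * X i = q * X i * X j := by ring
  have h2 : (q : ℂ) * X j * (X i)⁻¹ = q * X j / X i := by rw [div_eq_mul_inv]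
  have h3 : (q : ℂ) * (X j)⁻¹ * X i = q * X i / X j := by ring
  have h4 : (q : ℂ) * (X j)⁻¹ * (X i)⁻¹ = q / (X i * X j) := by
    rw [div_eq_mul_inv, mul_inv]; ring
  rw [h1, h2, h3, h4]
  ring

theorem momentDet_zero (hq0 : 0 < q) (hq1 : q < 1) {x : Fin n → ℂ} (hx : ∀ i, x i ≠ 0)
    (hqq : qp q q ≠ 0) (hP : ∏ j, ∏ k ∈ Ioi j, gq q (x j) (x k) ≠ 0) :
    momentDet q n 0 x = qp q q ^ n * (∏ j, (qp q (q * x j ^ 2) * qp q (q / x j ^ 2))) *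
      (∏ j, ∏ k ∈ Ioi j, gq q (x j) (x k)) *
        ((∏ j : Fin n, ∏ _k ∈ Ioi j, (-1)) * DeltaC n x) := by
  let X : ℕ → ℂ := fun i => if h : i < n then x ⟨i, h⟩ else 1
  have hXx : ∀ i : Fin n, X i = x i := fun i => by simp [X]
  have hX : ∀ i, X i ≠ 0 := fun i => by
    by_cases h : i < n
    · simp [X, h, hx]
    · simp [X, h]
  have h0 : ∏ m ∈ range (2 * n + 2), pairParams n X m = 0 :=
    Finset.prod_eq_zero (self_mem_range_succ _) (pairParams_of_le (Nat.le_succ _))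
  have h := qp_mul_momentDet (b := pairParams n X) hq0 hq1 hx (by simp [h0])
  rw [h0, mul_zero, qp_zero, one_mul, prod_prod_qp_pairParams hX, prod_range_prod_range] at h
  simp only [hXx] at h
  have hdet : momentDet q n (pairParams n X) x =
      (∏ j, ∏ i, gq q (x i) (x j)) * ((∏ j : Fin n, ∏ _k ∈ Ioi j, (-1)) * DeltaC n x) := by
    rw [DeltaC_eq_det hx, ← mul_assoc (∏ j : Fin n, ∏ _k ∈ Ioi j, (-1 : ℂ)),
      prod_prod_Ioi_neg_one_mul_self, one_mul, ← Matrix.det_mul_row, momentDet]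
    congr 1
    ext i j
    simp only [Matrix.of_apply]
    rw [← hXx j, wtMoment_pairParams hq0 hX j.2, wtMoment_pairParams hq0 hX j.2,
      Finset.prod_range]
    simp only [hXx]
    ring
  rw [hdet, prod_prod_of_symm _ fun i j => gq_comm _ _] at h
  have hself : ∏ j, gq q (x j) (x j) =
      (qp q q ^ n) ^ 2 * ∏ j, (qp q (q * x j ^ 2) * qp q (q / x j ^ 2)) := by
    rw [← pow_mul, mul_comm n, pow_mul]
    rw [show (qp q q ^ 2) ^ n = ∏ _j : Fin n, qp q q ^ 2 by simp, ← Finset.prod_mul_distrib]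
    exact Finset.prod_congr rfl fun j _ => gq_self (hx j)
  rw [hself] at h
  refine mul_left_cancel₀ (mul_ne_zero (pow_ne_zero n hqq) hP) ?_
  rw [← h]
  ring

end Special

section Theta

variable {q : ℝ}

theorem qp_ne_zero_of_norm_lt_one (hq0 : 0 < q) (hq1 : q < 1) {x : ℂ} (hx : ‖x‖ < 1) :
    qp q x ≠ 0 := by
  have h := tprod_one_add_ne_zero_of_summable (f := fun i : ℕ => -((q : ℂ) ^ i * x)) (fun i => by
    have hlt : ‖(q : ℂ) ^ i * x‖ < 1 := by
      rw [norm_mul, norm_pow]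
      exact mul_lt_one_of_nonneg_of_lt_one_right
        (pow_le_one₀ (norm_nonneg _) (norm_ofReal_lt_one hq0 hq1).le) (norm_nonneg _) hx
    intro h0
    rw [← sub_eq_add_neg, sub_eq_zero] at h0
    rw [← h0, norm_one] at hlt
    exact lt_irrefl _ hlt) (summable_norm_geometric_mul hq0 hq1 x)
  rw [qp]
  simpa only [← sub_eq_add_neg] using h

theorem th_mul (hq0 : 0 < q) (hq1 : q < 1) {y : ℂ} (hy : y ≠ 0) :
    th q (q * y) * -y = th q y := by
  have hQ : (q : ℂ) ≠ 0 := by exact_mod_cast hq0.ne'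
  unfold th
  rw [qp_eq_mul hq0 hq1 y, show (q : ℂ) / (q * y) = y⁻¹ by field_simp, qp_eq_mul hq0 hq1 y⁻¹,
    ← div_eq_mul_inv]
  field_simp
  ring

theorem th_zpow_mul (hq0 : 0 < q) (hq1 : q < 1) {y : ℂ} (hy : y ≠ 0) (ν : ℤ) :
    th q ((q : ℂ) ^ ν * y) * ((-y) ^ ν * (q : ℂ) ^ (((ν : ℂ) ^ 2 - ν) / 2)) = th q y := by
  have hQ : (q : ℂ) ≠ 0 := by exact_mod_cast hq0.ne'
  have step : ∀ ν : ℤ, th q ((q : ℂ) ^ (ν + 1) * y) *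
      ((-y) ^ (ν + 1) * (q : ℂ) ^ ((((ν + 1 : ℤ) : ℂ) ^ 2 - ((ν + 1 : ℤ) : ℂ)) / 2)) =
      th q ((q : ℂ) ^ ν * y) * ((-y) ^ ν * (q : ℂ) ^ (((ν : ℂ) ^ 2 - ν) / 2)) := by
    intro ν
    rw [← th_mul hq0 hq1 (mul_ne_zero (zpow_ne_zero ν hQ) hy), zpow_add_one₀ (neg_ne_zero.mpr hy),
      zpow_add_one₀ hQ, show ((((ν + 1 : ℤ) : ℂ) ^ 2 - ((ν + 1 : ℤ) : ℂ)) / 2) =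
        ((ν : ℂ) ^ 2 - ν) / 2 + ν by push_cast; ring, cpow_add _ _ hQ, cpow_intCast,
      show (q : ℂ) ^ ν * q * y = q * ((q : ℂ) ^ ν * y) by ring]
    ring
  induction ν using Int.induction_on with
  | zero => simp
  | succ i ih => rw [step, ih]
  | pred i ih => rw [← step, sub_add_cancel, ih]

theorem phi_factor (hq0 : 0 < q) (hq1 : q < 1) {a x : ℂ} (ha : a ≠ 0) (hx : x ≠ 0)
    (h : th q (a * x) ≠ 0) (c : ℂ) (ν : ℤ) :
    (q : ℂ) ^ ((ν : ℂ) / 2) * a ^ (-ν) * c *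
        (qp q (q * a⁻¹ * ((q : ℂ) ^ ν * x)) / qp q (a * ((q : ℂ) ^ ν * x))) =
      c / th q (a * x) * ((-x) ^ ν * (q : ℂ) ^ ((ν : ℂ) ^ 2 / 2) *
        (qp q (q * a⁻¹ * ((q : ℂ) ^ ν * x)) * qp q (q * a⁻¹ / ((q : ℂ) ^ ν * x)))) := by
  have hQ : (q : ℂ) ≠ 0 := by exact_mod_cast hq0.ne'
  have hax := mul_ne_zero ha hx
  have key := th_zpow_mul hq0 hq1 hax ν
  have hne : th q ((q : ℂ) ^ ν * (a * x)) ≠ 0 := fun h0 => h (by rw [← key, h0, zero_mul])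
  rw [show ((ν : ℂ) ^ 2 / 2) = ((ν : ℂ) ^ 2 - ν) / 2 + ν / 2 by ring, cpow_add _ _ hQ, ← key]
  rw [show (q : ℂ) ^ ν * (a * x) = a * ((q : ℂ) ^ ν * x) by ring] at hne ⊢
  have hz := zpow_mul_ne_zero hq0 hx ν
  have e : (q : ℂ) * a⁻¹ / ((q : ℂ) ^ ν * x) = q / (a * ((q : ℂ) ^ ν * x)) := by
    rw [← div_eq_mul_inv, div_div]
  rw [e]
  generalize (q : ℂ) ^ ν * x = z at *
  have hq2 : (q : ℂ) ^ (((ν : ℂ) ^ 2 - ν) / 2) ≠ 0 := by simp [cpow_eq_zero_iff, hQ]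
  have hxν : (-x) ^ ν ≠ 0 := zpow_ne_zero _ (neg_ne_zero.mpr hx)
  have haν : a ^ ν ≠ 0 := zpow_ne_zero _ ha
  rw [show -(a * x) = a * -x by ring, mul_zpow, zpow_neg]
  unfold th at hne ⊢
  have h1 := left_ne_zero_of_mul hne
  have h2 := right_ne_zero_of_mul hne
  generalize qp q (a * z) = A at *
  generalize qp q (q / (a * z)) = A' at *
  generalize qp q (q * a⁻¹ * z) = A'' at *
  generalize (q : ℂ) ^ (((ν : ℂ) ^ 2 - ν) / 2) = u at *
  generalize (-x) ^ ν = v at *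
  generalize a ^ ν = w at *
  field_simp

end Theta

section MultipleSum

variable {q : ℝ} {n : ℕ} {a α : Fin (2 * n + 2) → ℂ} {x : Fin n → ℂ} {b : ℕ → ℂ}

theorem prod_phi_eq_wt (hq0 : 0 < q) (hq1 : q < 1) (ha : ∀ m, a m ≠ 0) {x : ℂ} (hx : x ≠ 0)
    (h : ∀ m, th q (a m * x) ≠ 0) (hb : ∀ m : Fin (2 * n + 2), b m = (a m)⁻¹) (ν : ℤ) :
    ∏ m, ((q : ℂ) ^ ((ν : ℂ) / 2) * a m ^ (-ν) * x ^ ((1 : ℂ) / 2 - α m) *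
        (qp q (q * (a m)⁻¹ * ((q : ℂ) ^ ν * x)) / qp q (a m * ((q : ℂ) ^ ν * x)))) =
      (∏ m, x ^ ((1 : ℂ) / 2 - α m) / th q (a m * x)) * wt q n b x ν := by
  rw [Finset.prod_congr rfl fun m _ => phi_factor hq0 hq1 (ha m) hx (h m) _ ν,
    Finset.prod_mul_distrib, Finset.prod_mul_distrib, wt, Finset.prod_range]
  simp only [hb]
  congr 2
  rw [Finset.prod_const, Finset.card_univ, Fintype.card_fin, mul_pow, ← zpow_natCast,
    ← zpow_mul, ← cpow_nat_mul]
  congr 1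
  · push_cast
    rw [mul_comm ν, Even.neg_zpow ⟨(n + 1) * ν, by ring⟩]
  · rw [← cpow_intCast]
    congr 1
    push_cast
    ring

theorem gSummand_eq (hq0 : 0 < q) (hq1 : q < 1) (ha : ∀ m, a m ≠ 0) (hx : ∀ i, x i ≠ 0)
    (h : ∀ i m, th q (a m * x i) ≠ 0) (hb : ∀ m : Fin (2 * n + 2), b m = (a m)⁻¹)
    (ν : Fin n → ℤ) :
    gSummand q n a α x ν = (∏ i, ∏ m, x i ^ ((1 : ℂ) / 2 - α m) / th q (a m * x i)) *
      ((∏ i, wt q n b (x i) (ν i)) * DeltaC n fun i => (q : ℂ) ^ ν i * x i) := by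
  rw [gSummand, PhiGLat,
    Finset.prod_congr rfl fun i _ => prod_phi_eq_wt hq0 hq1 ha (hx i) (h i) hb (ν i),
    Finset.prod_mul_distrib, mul_assoc]

theorem summable_norm_prod_and_tsum_prod {n : ℕ} {f : Fin n → ℤ → ℂ}
    (hf : ∀ i, Summable fun ν => ‖f i ν‖) :
    (Summable fun ν : Fin n → ℤ => ‖∏ i, f i (ν i)‖) ∧
      ∑' ν : Fin n → ℤ, ∏ i, f i (ν i) = ∏ i, ∑' ν, f i ν := by
  induction n with
  | zero => exact ⟨(hasSum_fintype _).summable, by simp⟩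
  | succ n ih =>
    obtain ⟨h1, h2⟩ := ih (f := fun i => f i.succ) fun i => hf i.succ
    have e : ∀ p : ℤ × (Fin n → ℤ), ∏ i, f i (Fin.consEquiv (fun _ => ℤ) p i) =
        f 0 p.1 * ∏ i : Fin n, f i.succ (p.2 i) := fun p => by
      simp [Fin.prod_univ_succ, Fin.consEquiv]
    constructor
    · rw [← (Fin.consEquiv fun _ => ℤ).summable_iff]
      refine ((hf 0).mul_norm h1).congr fun p => ?_
      rw [Function.comp_apply, e]
    · rw [← (Fin.consEquiv fun _ => ℤ).tsum_eq, tsum_congr e,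
        ← tsum_mul_tsum_of_summable_norm (hf 0) h1, h2, Fin.prod_univ_succ]

theorem tsum_wt_mul_DeltaC (hq0 : 0 < q) (hq1 : q < 1) (hx : ∀ i, x i ≠ 0)
    (hB : q * ‖∏ m ∈ range (2 * n + 2), b m‖ < 1) :
    ∑' ν : Fin n → ℤ, ((∏ i, wt q n b (x i) (ν i)) * DeltaC n fun i => (q : ℂ) ^ ν i * x i) =
      (∏ j : Fin n, ∏ _k ∈ Ioi j, (-1)) * momentDet q n b x := by
  let h : Fin n → Fin n → ℤ → ℂ := fun i j ν =>
    wt q n b (x j) ν * ((q : ℂ) ^ ν * x j) ^ (-((i : ℕ) + 1 : ℤ)) -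
      wt q n b (x j) ν * ((q : ℂ) ^ ν * x j) ^ ((i : ℕ) + 1 : ℤ)
  have hk : ∀ i : Fin n, |((i : ℕ) : ℤ) + 1| ≤ n := fun i => by
    rw [abs_of_nonneg (by positivity)]
    exact_mod_cast i.2
  have s1 := fun i j => summable_wt_of_abs_le (b := b) (k := -((i : Fin n) + 1 : ℤ)) hq0 hq1 (hx j)
    (by rw [abs_neg]; exact hk i) hB
  have s2 := fun i j => summable_wt_of_abs_le (b := b) hq0 hq1 (hx j) (hk i) hB
  have hh : ∀ i j, Summable fun ν => ‖h i j ν‖ := fun i j => ((s1 i j).sub (s2 i j)).norm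
  have ht : ∀ i j, ∑' ν, h i j ν = wtMoment q n b (x j) (-((i : ℕ) + 1 : ℤ)) -
      wtMoment q n b (x j) ((i : ℕ) + 1 : ℤ) := fun i j => (s1 i j).tsum_sub (s2 i j)
  have e : ∀ ν : Fin n → ℤ,
      (∏ i, wt q n b (x i) (ν i)) * DeltaC n (fun i => (q : ℂ) ^ ν i * x i) =
      (∏ j : Fin n, ∏ _k ∈ Ioi j, (-1)) *
        ∑ σ : Equiv.Perm (Fin n), (Equiv.Perm.sign σ : ℂ) * ∏ j, h (σ j) j (ν j) := by
    intro ν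
    rw [DeltaC_eq_det fun i => zpow_mul_ne_zero hq0 (hx i) (ν i), mul_left_comm,
      ← Matrix.det_mul_row, Matrix.det_apply']
    simp only [Matrix.of_apply, mul_sub, h]
  have hp := fun σ : Equiv.Perm (Fin n) =>
    summable_norm_prod_and_tsum_prod fun j => hh (σ j) j
  rw [tsum_congr e, tsum_mul_left, Summable.tsum_finsetSum fun σ _ => (hp σ).1.of_norm.mul_left _,
    momentDet, Matrix.det_apply']
  congr 1
  refine Finset.sum_congr rfl fun σ _ => ?_
  rw [tsum_mul_left, (hp σ).2]
  simp only [ht, Matrix.of_apply]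

end MultipleSum

section Convergence

variable {q : ℝ}

theorem eventually_qp_ne_zero (hq0 : 0 < q) (hq1 : q < 1) (c x : ℂ) :
    ∀ᶠ t : ℕ in atTop, qp q (c * ((q : ℂ) ^ (t : ℤ) * x)) ≠ 0 := by
  have h := tendsto_qp hq0 hq1 ((tendsto_zpow_mul_zero hq0 hq1 x).const_mul c)
  rw [mul_zero, qp_zero] at h
  exact h.eventually_ne one_ne_zero

theorem DeltaC_succ (k : ℕ) (z : Fin (k + 1) → ℂ) :
    DeltaC (k + 1) z = (1 - z 0 ^ 2) / z 0 *
      (∏ j : Fin k, ((1 - z 0 / z j.succ) * (1 - z 0 * z j.succ) / z 0)) *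
        DeltaC k fun i => z i.succ := by
  unfold DeltaC
  rw [Fin.prod_univ_succ, Fin.prod_univ_succ, Fin.prod_Ioi_zero]
  simp only [Fin.prod_Ioi_succ]
  ring

theorem eventually_DeltaC_ne_zero (hq0 : 0 < q) (hq1 : q < 1) {n : ℕ} {x : Fin n → ℂ}
    (hx : ∀ i, x i ≠ 0) (hd : ∀ j, ∀ k ∈ Ioi j, 1 - x j / x k ≠ 0) :
    ∀ᶠ t : ℕ in atTop, DeltaC n (fun i => (q : ℂ) ^ (t : ℤ) * x i) ≠ 0 := by
  have hz := fun i => tendsto_zpow_mul_zero hq0 hq1 (x i)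
  have h1 : ∀ i j, ∀ᶠ t : ℕ in atTop,
      1 - (q : ℂ) ^ (t : ℤ) * x i * ((q : ℂ) ^ (t : ℤ) * x j) ≠ 0 := fun i j => by
    refine Tendsto.eventually_ne (((hz i).mul (hz j)).const_sub 1) ?_
    simp
  have h2 : ∀ᶠ t : ℕ in atTop, ∀ i j,
      1 - (q : ℂ) ^ (t : ℤ) * x i * ((q : ℂ) ^ (t : ℤ) * x j) ≠ 0 :=
    eventually_all.mpr fun i => eventually_all.mpr fun j => h1 i j
  filter_upwards [h2] with t ht
  have hz0 := fun i => zpow_mul_ne_zero hq0 (hx i) (t : ℤ)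
  have hQ : (q : ℂ) ^ (t : ℤ) ≠ 0 := zpow_ne_zero _ (by exact_mod_cast hq0.ne')
  refine mul_ne_zero (Finset.prod_ne_zero_iff.mpr fun i _ => ?_)
    (Finset.prod_ne_zero_iff.mpr fun j _ => Finset.prod_ne_zero_iff.mpr fun k hk => ?_)
  · rw [sq]
    exact div_ne_zero (ht i i) (hz0 i)
  · rw [mul_div_mul_left _ _ hQ]
    exact div_ne_zero (mul_ne_zero (hd j k hk) (ht j k)) (hz0 j)

theorem norm_lt_one_of_summable_gSummand (hq0 : 0 < q) (hq1 : q < 1) {n : ℕ} (hn : 1 ≤ n)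
    {a α : Fin (2 * n + 2) → ℂ} (ha : ∀ m, a m ≠ 0) {x : Fin n → ℂ} (hx : ∀ i, x i ≠ 0)
    (hd : ∀ j, ∀ k ∈ Ioi j, 1 - x j / x k ≠ 0) (hconv : Summable (gSummand q n a α x)) :
    ‖(q : ℂ) * ∏ m, (a m)⁻¹‖ < 1 := by
  obtain ⟨k, rfl⟩ : ∃ k, n = k + 1 := ⟨n - 1, by omega⟩
  have hQ : (q : ℂ) ≠ 0 := by exact_mod_cast hq0.ne'
  let φ : Fin (k + 1) → ℤ → ℂ := fun i ν =>
    ∏ m, ((q : ℂ) ^ ((ν : ℂ) / 2) * a m ^ (-ν) * x i ^ ((1 : ℂ) / 2 - α m) *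
      (qp q ((q : ℂ) * (a m)⁻¹ * ((q : ℂ) ^ ν * x i)) / qp q (a m * ((q : ℂ) ^ ν * x i))))
  have hφ : ∀ᶠ s : ℕ in atTop, ∀ i : Fin k, φ i.succ s ≠ 0 := by
    refine eventually_all.mpr fun i => ?_
    have h : ∀ᶠ s : ℕ in atTop, ∀ m, qp q (q * (a m)⁻¹ * ((q : ℂ) ^ (s : ℤ) * x i.succ)) ≠ 0 ∧
        qp q (a m * ((q : ℂ) ^ (s : ℤ) * x i.succ)) ≠ 0 := eventually_all.mpr fun m =>
      (eventually_qp_ne_zero hq0 hq1 _ _).and (eventually_qp_ne_zero hq0 hq1 _ _)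
    filter_upwards [h] with s hs
    refine Finset.prod_ne_zero_iff.mpr fun m _ => mul_ne_zero (mul_ne_zero (mul_ne_zero ?_ ?_) ?_)
      (div_ne_zero (hs m).1 (hs m).2)
    · simp [cpow_eq_zero_iff, hQ]
    · exact zpow_ne_zero _ (ha m)
    · simp [cpow_eq_zero_iff, hx]
  have hΔ := eventually_DeltaC_ne_zero (x := fun i : Fin k => x i.succ) hq0 hq1
    (fun i => hx i.succ) fun j l hl => hd j.succ l.succ (by simpa using hl)
  obtain ⟨s, hs1, hs2⟩ := (hφ.and hΔ).exists
  let ν : ℕ → Fin (k + 1) → ℤ := fun t => Fin.cons (t : ℤ) fun _ => (s : ℤ)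
  have hν : Function.Injective ν := fun t t' h => by
    have := congrFun h 0
    simpa [ν] using this
  let C : ℕ → ℂ := fun t => (∏ m, (x 0 ^ ((1 : ℂ) / 2 - α m) *
      (qp q ((q : ℂ) * (a m)⁻¹ * ((q : ℂ) ^ (t : ℤ) * x 0)) /
        qp q (a m * ((q : ℂ) ^ (t : ℤ) * x 0))))) *
    (∏ i : Fin k, φ i.succ s) * ((1 - ((q : ℂ) ^ (t : ℤ) * x 0) ^ 2) / x 0 *
      (∏ j : Fin k, ((1 - (q : ℂ) ^ (t : ℤ) * x 0 / ((q : ℂ) ^ (s : ℤ) * x j.succ)) *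
        (1 - (q : ℂ) ^ (t : ℤ) * x 0 * ((q : ℂ) ^ (s : ℤ) * x j.succ)) / x 0)) *
      DeltaC k fun i => (q : ℂ) ^ (s : ℤ) * x i.succ)
  have hC : Tendsto C atTop (𝓝 ((∏ m, (x 0 ^ ((1 : ℂ) / 2 - α m) * (1 / 1))) *
      (∏ i : Fin k, φ i.succ s) * ((1 - 0 ^ 2) / x 0 *
        (∏ j : Fin k, ((1 - 0 / ((q : ℂ) ^ (s : ℤ) * x j.succ)) *
          (1 - 0 * ((q : ℂ) ^ (s : ℤ) * x j.succ)) / x 0)) *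
        DeltaC k fun i => (q : ℂ) ^ (s : ℤ) * x i.succ))) := by
    have hz := tendsto_zpow_mul_zero hq0 hq1 (x 0)
    have hqp : ∀ c : ℂ, Tendsto (fun t : ℕ => qp q (c * ((q : ℂ) ^ (t : ℤ) * x 0))) atTop
        (𝓝 1) := fun c => by
      simpa using tendsto_qp hq0 hq1 (hz.const_mul c)
    refine ((tendsto_finsetProd _ fun m _ => ?_).mul_const _).mul
      (((((hz.pow 2).const_sub 1).div_const _).mul (tendsto_finsetProd _ fun j _ => ?_)).mul_const _)
    · exact ((hqp _).div (hqp _) one_ne_zero).const_mul _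
    · exact (((hz.div_const _).const_sub 1).mul ((hz.mul_const _).const_sub 1)).div_const _
  have hterm : ∀ t, gSummand q (k + 1) a α x (ν t) = (q * ∏ m, (a m)⁻¹) ^ t * C t := by
    intro t
    have hx0 := hx 0
    have hφ0 : φ 0 t = ((q : ℂ) ^ (k + 2) * ∏ m, (a m)⁻¹) ^ t *
        ∏ m, (x 0 ^ ((1 : ℂ) / 2 - α m) *
          (qp q ((q : ℂ) * (a m)⁻¹ * ((q : ℂ) ^ (t : ℤ) * x 0)) /
            qp q (a m * ((q : ℂ) ^ (t : ℤ) * x 0)))) := by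
      have e : ((q : ℂ) ^ (k + 2) * ∏ m, (a m)⁻¹) ^ t =
          ∏ m, ((q : ℂ) ^ (((t : ℤ) : ℂ) / 2) * a m ^ (-(t : ℤ))) := by
        rw [Finset.prod_mul_distrib, Finset.prod_const, Finset.card_univ, Fintype.card_fin,
          mul_pow, ← Finset.prod_pow, ← cpow_nat_mul, ← pow_mul, ← cpow_natCast]
        congr 1
        · congr 1
          push_cast
          ring
        · exact Finset.prod_congr rfl fun m _ => by rw [zpow_neg, zpow_natCast, inv_pow]
      rw [e, ← Finset.prod_mul_distrib]
      exact Finset.prod_congr rfl fun m _ => by ring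
    have hPhi : PhiGLat q (k + 1) a α x (ν t) = φ 0 t * ∏ i : Fin k, φ i.succ s := by
      rw [PhiGLat, Fin.prod_univ_succ]
      rfl
    rw [gSummand, hPhi, hφ0, DeltaC_succ]
    simp only [C, ν, Fin.cons_zero, Fin.cons_succ]
    have hqt : (q : ℂ) ^ (t : ℤ) = (q : ℂ) ^ t := zpow_natCast _ _
    have e2 : ∏ j : Fin k, ((1 - (q : ℂ) ^ (t : ℤ) * x 0 / ((q : ℂ) ^ (s : ℤ) * x j.succ)) *
        (1 - (q : ℂ) ^ (t : ℤ) * x 0 * ((q : ℂ) ^ (s : ℤ) * x j.succ)) / x 0) =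
        ((q : ℂ) ^ t) ^ k *
        ∏ j : Fin k, ((1 - (q : ℂ) ^ (t : ℤ) * x 0 / ((q : ℂ) ^ (s : ℤ) * x j.succ)) *
          (1 - (q : ℂ) ^ (t : ℤ) * x 0 * ((q : ℂ) ^ (s : ℤ) * x j.succ)) /
            ((q : ℂ) ^ (t : ℤ) * x 0)) := by
      rw [show ((q : ℂ) ^ t) ^ k = ∏ _j : Fin k, (q : ℂ) ^ t by simp, ← Finset.prod_mul_distrib]
      refine Finset.prod_congr rfl fun j _ => ?_
      rw [hqt]
      generalize (1 - (q : ℂ) ^ t * x 0 / ((q : ℂ) ^ (s : ℤ) * x j.succ)) *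
        (1 - (q : ℂ) ^ t * x 0 * ((q : ℂ) ^ (s : ℤ) * x j.succ)) = y
      field_simp
    have e3 : (1 - ((q : ℂ) ^ (t : ℤ) * x 0) ^ 2) / x 0 =
        (q : ℂ) ^ t * ((1 - ((q : ℂ) ^ (t : ℤ) * x 0) ^ 2) / ((q : ℂ) ^ (t : ℤ) * x 0)) := by
      rw [hqt]
      generalize 1 - ((q : ℂ) ^ t * x 0) ^ 2 = y
      field_simp
    rw [e2, e3, mul_pow, mul_pow]
    ring
  have hlim := (hconv.comp_injective hν).tendsto_atTop_zero
  have hL : (∏ m, (x 0 ^ ((1 : ℂ) / 2 - α m) * (1 / 1))) *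
      (∏ i : Fin k, φ i.succ s) * ((1 - 0 ^ 2) / x 0 *
        (∏ j : Fin k, ((1 - 0 / ((q : ℂ) ^ (s : ℤ) * x j.succ)) *
          (1 - 0 * ((q : ℂ) ^ (s : ℤ) * x j.succ)) / x 0)) *
        DeltaC k fun i => (q : ℂ) ^ (s : ℤ) * x i.succ) ≠ 0 := by
    refine mul_ne_zero (mul_ne_zero (Finset.prod_ne_zero_iff.mpr fun m _ => ?_)
      (Finset.prod_ne_zero_iff.mpr fun i _ => hs1 i))
      (mul_ne_zero (mul_ne_zero ?_ (Finset.prod_ne_zero_iff.mpr fun j _ => ?_)) hs2)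
    · simp [cpow_eq_zero_iff, hx]
    · simp [hx]
    · simp [hx]
  have hpow := hlim.div hC hL
  rw [zero_div] at hpow
  refine tendsto_pow_atTop_nhds_zero_iff_norm_lt_one.mp (hpow.congr' ?_)
  filter_upwards [hC.eventually_ne hL] with t ht
  rw [Pi.div_apply, Function.comp_apply, hterm, mul_div_cancel_right₀ _ ht]

end Convergence

section Normalization

variable {q : ℝ} {n : ℕ} {x : Fin n → ℂ}

theorem th_sq (hq0 : 0 < q) (hq1 : q < 1) (u : ℂ) :
    th q (u ^ 2) = (1 - u ^ 2) * (qp q (q * u ^ 2) * qp q (q / u ^ 2)) := by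
  rw [th, qp_eq_mul hq0 hq1, mul_assoc]

theorem th_div_mul_th_mul (hq0 : 0 < q) (hq1 : q < 1) (u v : ℂ) :
    th q (u / v) * th q (u * v) = (1 - u / v) * (1 - u * v) * gq q u v := by
  rw [th, th, gq, qp_eq_mul hq0 hq1 (u / v), qp_eq_mul hq0 hq1 (u * v), ← mul_div_assoc,
    ← mul_assoc (q : ℂ) u v, div_div_eq_mul_div]
  ring

theorem prod_cpow {ι : Type*} (s : Finset ι) {u : ℂ} (hu : u ≠ 0) (f : ι → ℂ) :
    ∏ i ∈ s, u ^ f i = u ^ ∑ i ∈ s, f i := by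
  classical
  induction s using Finset.induction_on with
  | empty => simp
  | insert i s hi ih => rw [Finset.prod_insert hi, Finset.sum_insert hi, cpow_add _ _ hu, ih]

theorem prod_pow_mul_DeltaC (hx : ∀ i, x i ≠ 0) :
    (∏ i : Fin n, x i ^ (n - i : ℕ)) * DeltaC n x =
      (∏ i, (1 - x i ^ 2)) * ∏ j, ∏ k ∈ Ioi j, ((1 - x j / x k) * (1 - x j * x k)) := by
  have h : ∏ i : Fin n, x i ^ (n - i : ℕ) = (∏ i, x i) * ∏ j, ∏ _k ∈ Ioi j, x j := by
    rw [← Finset.prod_mul_distrib]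
    refine Finset.prod_congr rfl fun i _ => ?_
    rw [Finset.prod_const, Fin.card_Ioi, ← pow_succ']
    congr 1
    omega
  rw [h, DeltaC, mul_mul_mul_comm, ← Finset.prod_mul_distrib, ← Finset.prod_mul_distrib]
  congr 1
  · exact Finset.prod_congr rfl fun i _ => mul_div_cancel₀ _ (hx i)
  · refine Finset.prod_congr rfl fun j _ => ?_
    rw [← Finset.prod_mul_distrib]
    exact Finset.prod_congr rfl fun k _ => mul_div_cancel₀ _ (hx j)

theorem ThetaG_eq (hq0 : 0 < q) (hq1 : q < 1) (a α : Fin (2 * n + 2) → ℂ) (hx : ∀ i, x i ≠ 0) :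
    ThetaG q n a α x = (∏ i, ∏ m, x i ^ ((1 : ℂ) / 2 - α m) / th q (a m * x i)) *
      (DeltaC n x * (∏ j, (qp q (q * x j ^ 2) * qp q (q / x j ^ 2))) *
        ∏ j, ∏ k ∈ Ioi j, gq q (x j) (x k)) := by
  have e : ∀ i : Fin n, ∏ m, x i ^ ((1 : ℂ) / 2 - α m) / th q (a m * x i) =
      x i ^ (((i : ℕ) + 1 : ℂ) - ∑ m, α m) / (∏ m, th q (a m * x i)) * x i ^ (n - i : ℕ) := by
    intro i
    rw [Finset.prod_div_distrib, prod_cpow _ (hx i), Finset.sum_sub_distrib, Finset.sum_const,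
      Finset.card_univ, Fintype.card_fin, div_mul_eq_mul_div, ← cpow_natCast,
      ← cpow_add _ _ (hx i), Nat.cast_sub i.2.le]
    congr 2
    simp
    ring
  have e2 : ∏ j, ∏ k ∈ Ioi j, (th q (x j / x k) * th q (x j * x k)) =
      (∏ j, ∏ k ∈ Ioi j, ((1 - x j / x k) * (1 - x j * x k))) *
        ∏ j, ∏ k ∈ Ioi j, gq q (x j) (x k) := by
    simp only [th_div_mul_th_mul hq0 hq1, Finset.prod_mul_distrib]
  have h := prod_pow_mul_DeltaC hx
  rw [ThetaG, e2]
  simp only [e, th_sq hq0 hq1, Finset.prod_mul_distrib, Finset.prod_div_distrib] at h ⊢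
  linear_combination (-(∏ i : Fin n, x i ^ (((i : ℕ) + 1 : ℂ) - ∑ m, α m)) /
    (∏ i : Fin n, ∏ m, th q (a m * x i)) * ((∏ j, qp q (q * x j ^ 2)) * ∏ j, qp q (q / x j ^ 2)) *
      ∏ j, ∏ k ∈ Ioi j, gq q (x j) (x k)) * h

end Normalization

/-- **Gustafson's `C_n` summation formula.**
`⟨⟨1,x⟩⟩_G = (1-q)^n (q)_∞^n ∏_{i<j} (q a_i⁻¹ a_j⁻¹)_∞ / (q a₁⁻¹⋯a_{2n+2}⁻¹)_∞`. -/
theorem stmt9 (q : ℝ) (hq0 : 0 < q) (hq1 : q < 1) (n : ℕ) (hn : 1 ≤ n)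
    (a α : Fin (2 * n + 2) → ℂ) (ha : ∀ m, a m = (q : ℂ) ^ α m)
    (hbal : ∏ m, a m ≠ 1)
    (x : Fin n → ℂ) (hx : ∀ i, x i ≠ 0)
    (hconv : Summable fun ν : Fin n → ℤ => ‖gSummand q n a α x ν‖)
    (hΘ : ThetaG q n a α x ≠ 0) :
    gInt q n a α x / ThetaG q n a α x =
      (1 - (q : ℂ)) ^ n * qp q (q : ℂ) ^ n *
        (∏ i, ∏ j ∈ Ioi i, qp q ((q : ℂ) * (a i)⁻¹ * (a j)⁻¹)) /
        qp q ((q : ℂ) * ∏ m, (a m)⁻¹) := by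
  have hQ : (q : ℂ) ≠ 0 := by exact_mod_cast hq0.ne'
  have ha0 : ∀ m, a m ≠ 0 := fun m => by simp [ha, cpow_eq_zero_iff, hQ]
  have hth : ∀ i m, th q (a m * x i) ≠ 0 := fun i m => by
    have h := Finset.prod_ne_zero_iff.mp (left_ne_zero_of_mul hΘ) i (mem_univ i)
    exact Finset.prod_ne_zero_iff.mp (fun h0 => h (by rw [h0, div_zero])) m (mem_univ m)
  have hpair : ∀ j, ∀ k ∈ Ioi j, th q (x j / x k) * th q (x j * x k) ≠ 0 := fun j k hk =>
    Finset.prod_ne_zero_iff.mp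
      (Finset.prod_ne_zero_iff.mp (right_ne_zero_of_mul hΘ) j (mem_univ j)) k hk
  simp only [th_div_mul_th_mul hq0 hq1] at hpair
  have hB := norm_lt_one_of_summable_gSummand hq0 hq1 hn ha0 hx
    (fun j k hk => left_ne_zero_of_mul (left_ne_zero_of_mul (hpair j k hk))) hconv.of_norm
  have hP : ∏ j, ∏ k ∈ Ioi j, gq q (x j) (x k) ≠ 0 := Finset.prod_ne_zero_iff.mpr fun j _ =>
    Finset.prod_ne_zero_iff.mpr fun k hk => right_ne_zero_of_mul (hpair j k hk)
  let b : ℕ → ℂ := fun m => if h : m < 2 * n + 2 then (a ⟨m, h⟩)⁻¹ else 0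
  have hb : ∀ m : Fin (2 * n + 2), b m = (a m)⁻¹ := fun m => by simp [b]
  have hbprod : ∏ m ∈ range (2 * n + 2), b m = ∏ m, (a m)⁻¹ := by
    rw [Finset.prod_range]
    exact Finset.prod_congr rfl fun m _ => hb m
  have hB' : q * ‖∏ m ∈ range (2 * n + 2), b m‖ < 1 := by
    rwa [norm_mul, Complex.norm_real, Real.norm_of_nonneg hq0.le, ← hbprod] at hB
  have hdet := qp_mul_momentDet hq0 hq1 hx hB'
  rw [hbprod, momentDet_zero hq0 hq1 hx
    (qp_ne_zero_of_norm_lt_one hq0 hq1 (norm_ofReal_lt_one hq0 hq1)) hP,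
    prod_range_prod_range fun i j => qp q (q * b j * b i)] at hdet
  have hR : ∏ i : Fin (2 * n + 2), ∏ j ∈ Ioi i, qp q (q * b j * b i) =
      ∏ i, ∏ j ∈ Ioi i, qp q ((q : ℂ) * (a i)⁻¹ * (a j)⁻¹) := by
    simp only [hb, mul_right_comm (q : ℂ)]
  rw [hR] at hdet
  have hε := prod_prod_Ioi_neg_one_mul_self n
  rw [div_eq_div_iff hΘ (qp_ne_zero_of_norm_lt_one hq0 hq1 hB), gInt,
    tsum_congr (gSummand_eq hq0 hq1 ha0 hx hth hb), tsum_mul_left,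
    tsum_wt_mul_DeltaC hq0 hq1 hx hB', ThetaG_eq hq0 hq1 a α hx]
  set K := ∏ i, ∏ m, x i ^ ((1 : ℂ) / 2 - α m) / th q (a m * x i)
  set R := ∏ i, ∏ j ∈ Ioi i, qp q ((q : ℂ) * (a i)⁻¹ * (a j)⁻¹)
  set Q := ∏ j, (qp q (q * x j ^ 2) * qp q (q / x j ^ 2))
  set P := ∏ j, ∏ k ∈ Ioi j, gq q (x j) (x k)
  set ε := ∏ j : Fin n, ∏ _k ∈ Ioi j, (-1 : ℂ)
  linear_combination ((1 - (q : ℂ)) ^ n * K * ε) * hdet +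
    ((1 - (q : ℂ)) ^ n * K * R * qp q q ^ n * Q * P * DeltaC n x) * hε
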